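/- There exists a positive constant C depending only on β and the initial data such that for every T > 0: ∫₀ᵀ ∫₀¹ θ^β θ_x² dx dt ≤ C + C ∫₀ᵀ (∫₀¹ (w_x + u − θ)² dx)² dt. -/

import Mathlib

open MeasureTheory Real Set Filter Topology

/-- A classical solution on `[0,1] × [0,∞)` of the rescaled stress-free
one-dimensional compressible Navier–Stokes system
`u_t + u = v_x`, `v_t = ((v_x - θ)/u)_x`,
`θ_t = -θ v_x/u + v_x²/u + (θ^β θ_x/u)_x` (β > 0),
with stress-free, thermally insulated boundary conditions and positive data. -/
structure NSSol where
  β : ℝ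
  hβ : 0 < β
  u : ℝ → ℝ → ℝ
  v : ℝ → ℝ → ℝ
  θ : ℝ → ℝ → ℝ
  ux : ℝ → ℝ → ℝ
  ut : ℝ → ℝ → ℝ
  vx : ℝ → ℝ → ℝ
  vt : ℝ → ℝ → ℝ
  vxx : ℝ → ℝ → ℝ
  θx : ℝ → ℝ → ℝ
  θt : ℝ → ℝ → ℝ
  θxx : ℝ → ℝ → ℝ
  hu_pos : ∀ x ∈ Icc (0:ℝ) 1, ∀ t ∈ Ici (0:ℝ), 0 < u x t
  hθ_pos : ∀ x ∈ Icc (0:ℝ) 1, ∀ t ∈ Ici (0:ℝ), 0 < θ x t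
  hux : ∀ x ∈ Icc (0:ℝ) 1, ∀ t ∈ Ici (0:ℝ),
    HasDerivWithinAt (fun y => u y t) (ux x t) (Icc 0 1) x
  hut : ∀ x ∈ Icc (0:ℝ) 1, ∀ t ∈ Ici (0:ℝ),
    HasDerivWithinAt (fun s => u x s) (ut x t) (Ici 0) t
  hvx : ∀ x ∈ Icc (0:ℝ) 1, ∀ t ∈ Ici (0:ℝ),
    HasDerivWithinAt (fun y => v y t) (vx x t) (Icc 0 1) x
  hvt : ∀ x ∈ Icc (0:ℝ) 1, ∀ t ∈ Ici (0:ℝ),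
    HasDerivWithinAt (fun s => v x s) (vt x t) (Ici 0) t
  hvxx : ∀ x ∈ Icc (0:ℝ) 1, ∀ t ∈ Ici (0:ℝ),
    HasDerivWithinAt (fun y => vx y t) (vxx x t) (Icc 0 1) x
  hθx : ∀ x ∈ Icc (0:ℝ) 1, ∀ t ∈ Ici (0:ℝ),
    HasDerivWithinAt (fun y => θ y t) (θx x t) (Icc 0 1) x
  hθt : ∀ x ∈ Icc (0:ℝ) 1, ∀ t ∈ Ici (0:ℝ),
    HasDerivWithinAt (fun s => θ x s) (θt x t) (Ici 0) t
  hθxx : ∀ x ∈ Icc (0:ℝ) 1, ∀ t ∈ Ici (0:ℝ),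
    HasDerivWithinAt (fun y => θx y t) (θxx x t) (Icc 0 1) x
  hu_cont : ContinuousOn (Function.uncurry u) (Icc 0 1 ×ˢ Ici 0)
  hv_cont : ContinuousOn (Function.uncurry v) (Icc 0 1 ×ˢ Ici 0)
  hθ_cont : ContinuousOn (Function.uncurry θ) (Icc 0 1 ×ˢ Ici 0)
  hux_cont : ContinuousOn (Function.uncurry ux) (Icc 0 1 ×ˢ Ici 0)
  hut_cont : ContinuousOn (Function.uncurry ut) (Icc 0 1 ×ˢ Ici 0)
  hvx_cont : ContinuousOn (Function.uncurry vx) (Icc 0 1 ×ˢ Ici 0)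
  hvt_cont : ContinuousOn (Function.uncurry vt) (Icc 0 1 ×ˢ Ici 0)
  hvxx_cont : ContinuousOn (Function.uncurry vxx) (Icc 0 1 ×ˢ Ici 0)
  hθx_cont : ContinuousOn (Function.uncurry θx) (Icc 0 1 ×ˢ Ici 0)
  hθt_cont : ContinuousOn (Function.uncurry θt) (Icc 0 1 ×ˢ Ici 0)
  hθxx_cont : ContinuousOn (Function.uncurry θxx) (Icc 0 1 ×ˢ Ici 0)
  mass : ∀ x ∈ Icc (0:ℝ) 1, ∀ t ∈ Ici (0:ℝ), ut x t + u x t = vx x t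
  momentum : ∀ x ∈ Icc (0:ℝ) 1, ∀ t ∈ Ici (0:ℝ),
    HasDerivWithinAt (fun y => (vx y t - θ y t) / u y t) (vt x t) (Icc 0 1) x
  energyEq : ∀ x ∈ Icc (0:ℝ) 1, ∀ t ∈ Ici (0:ℝ),
    HasDerivWithinAt (fun y => θ y t ^ β * θx y t / u y t)
      (θt x t + θ x t * vx x t / u x t - (vx x t) ^ 2 / u x t) (Icc 0 1) x
  bc0 : ∀ t ∈ Ici (0:ℝ), (vx 0 t - θ 0 t) / u 0 t = 0
  bc1 : ∀ t ∈ Ici (0:ℝ), (vx 1 t - θ 1 t) / u 1 t = 0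
  bcθ0 : ∀ t ∈ Ici (0:ℝ), θx 0 t = 0
  bcθ1 : ∀ t ∈ Ici (0:ℝ), θx 1 t = 0

namespace NSSol

/-- The initial energy `E₀ = ∫₀¹ (v₀²/2 + θ₀) dx`. -/
noncomputable def E₀ (S : NSSol) : ℝ := ∫ x in (0:ℝ)..1, ((S.v x 0) ^ 2 / 2 + S.θ x 0)

/-- The dissipation functional
`V(t) = ∫₀¹ (θ^β θ_x²/(uθ²) + (v_x − θ)²/(uθ)) dx`. -/
noncomputable def V (S : NSSol) (t : ℝ) : ℝ :=
  ∫ x in (0:ℝ)..1,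
    (S.θ x t ^ S.β * (S.θx x t) ^ 2 / (S.u x t * (S.θ x t) ^ 2)
      + (S.vx x t - S.θ x t) ^ 2 / (S.u x t * S.θ x t))

/-- The auxiliary velocity
`w(x,t) = v(x,t) − ∫₀¹ v₀ dξ − ∫₀ˣ u(ξ,t) dξ + ∫₀¹∫₀^ξ u(η,t) dη dξ`,
which satisfies `w_x = v_x − u` and `∫₀¹ w dx = 0`. -/
noncomputable def w (S : NSSol) (x t : ℝ) : ℝ :=
  S.v x t - (∫ ξ in (0:ℝ)..1, S.v ξ 0) - (∫ ξ in (0:ℝ)..x, S.u ξ t)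
    + ∫ ξ in (0:ℝ)..1, ∫ η in (0:ℝ)..ξ, S.u η t

/-- The asymptotic state `A = 2√(36 + 3(2E₀ − (∫₀¹ v₀ dx)²)) − 12`. -/
noncomputable def A (S : NSSol) : ℝ :=
  2 * Real.sqrt (36 + 3 * (2 * S.E₀ - (∫ x in (0:ℝ)..1, S.v x 0) ^ 2)) - 12

end NSSol

/-- The fundamental theorem of calculus on a subinterval of `[0,1]`, with one-sided derivatives. -/
theorem integral_eq_sub_of_hasDerivWithinAt_Icc {f f' : ℝ → ℝ} {c d a b : ℝ} (hca : c ≤ a)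
    (hab : a ≤ b) (hbd : b ≤ d)
    (hf : ∀ x ∈ Icc c d, HasDerivWithinAt f (f' x) (Icc c d) x)
    (hf' : IntervalIntegrable f' volume a b) : ∫ x in a..b, f' x = f b - f a := by
  have hsub : Icc a b ⊆ Icc c d := Icc_subset_Icc hca hbd
  refine intervalIntegral.integral_eq_sub_of_hasDerivAt_of_le hab
    (fun x hx => ((hf x (hsub hx)).continuousWithinAt).mono hsub) (fun x hx => ?_) hf'
  exact (hf x (hsub (Ioo_subset_Icc_self hx))).hasDerivAt
    (Icc_mem_nhds (hca.trans_lt hx.1) (hx.2.trans_le hbd))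

/-- The fundamental theorem of calculus on `[0,T]`, with one-sided derivatives on `[0,∞)`. -/
theorem integral_eq_sub_of_hasDerivWithinAt_Ici {f f' : ℝ → ℝ} {T : ℝ} (hT : 0 ≤ T)
    (hf : ∀ t, 0 ≤ t → HasDerivWithinAt f (f' t) (Ici 0) t)
    (hf' : IntervalIntegrable f' volume 0 T) : ∫ t in (0:ℝ)..T, f' t = f T - f 0 :=
  integral_eq_sub_of_hasDerivWithinAt_Icc le_rfl hT le_rfl
    (fun t ht => (hf t ht.1).mono Icc_subset_Ici_self) hf'

/-- Comparison of increments through comparison of derivatives. -/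
theorem sub_le_sub_of_hasDerivWithinAt_le {f f' g g' : ℝ → ℝ} {T : ℝ} (hT : 0 ≤ T)
    (hf : ∀ t, 0 ≤ t → HasDerivWithinAt f (f' t) (Ici 0) t)
    (hg : ∀ t, 0 ≤ t → HasDerivWithinAt g (g' t) (Ici 0) t)
    (h : ∀ t, 0 ≤ t → t ≤ T → f' t ≤ g' t) : f T - f 0 ≤ g T - g 0 := by
  have key : MonotoneOn (fun t => g t - f t) (Icc 0 T) := by
    have hd : ∀ t ∈ Ioo (0:ℝ) T, HasDerivAt (fun t => g t - f t) (g' t - f' t) t := fun t ht =>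
      ((hg t ht.1.le).sub (hf t ht.1.le)).hasDerivAt (Ici_mem_nhds ht.1)
    refine monotoneOn_of_deriv_nonneg (convex_Icc 0 T) (fun t ht => ?_) ?_ ?_
    · exact ((hg t ht.1).sub (hf t ht.1)).continuousWithinAt.mono Icc_subset_Ici_self
    · rw [interior_Icc]
      exact fun t ht => (hd t ht).differentiableAt.differentiableWithinAt
    · rw [interior_Icc]
      intro t ht
      rw [(hd t ht).deriv]
      exact sub_nonneg.2 (h t ht.1.le ht.2.le)
  have := key (left_mem_Icc.2 hT) (right_mem_Icc.2 hT) hT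
  simp only at this
  linarith

/-- A function that increases whenever it takes the value `m` stays above `m`. -/
theorem le_of_hasDerivWithinAt_pos_of_eq {f f' : ℝ → ℝ} {m T : ℝ} (hT : 0 ≤ T)
    (hf : ∀ t, 0 ≤ t → HasDerivWithinAt f (f' t) (Ici 0) t) (h0 : m ≤ f 0)
    (h : ∀ t, 0 ≤ t → f t = m → 0 < f' t) : m ≤ f T := by
  have hc : ContinuousOn (fun t => -f t) (Icc 0 T) := fun t ht =>
    ((hf t ht.1).neg).continuousWithinAt.mono Icc_subset_Ici_self
  have := image_le_of_deriv_right_lt_deriv_boundary (f := fun t => -f t) (f' := fun t => -f' t)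
    (B := fun _ => -m) (B' := fun _ => 0) hc
    (fun t ht => ((hf t ht.1).neg).mono (Ici_subset_Ici.2 ht.1)) (neg_le_neg h0)
    (fun t => hasDerivAt_const t _)
    (fun t ht hfm => by have := h t ht.1 (neg_injective hfm); linarith)
    (right_mem_Icc.2 hT)
  linarith

/-- Differentiation under the integral sign on a compact interval, for functions with a jointly
continuous one-sided time derivative. -/
theorem hasDerivWithinAt_intervalIntegral {f f' : ℝ → ℝ → ℝ} {a b : ℝ} (hab : a ≤ b)
    (hf' : Continuous (Function.uncurry f')) (hf₀ : IntervalIntegrable (fun x => f x 0) volume a b)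
    (hf : ∀ x ∈ Icc a b, ∀ t, 0 ≤ t → HasDerivWithinAt (f x) (f' x t) (Ici 0) t)
    {t : ℝ} (ht : 0 ≤ t) :
    HasDerivWithinAt (fun s => ∫ x in a..b, f x s) (∫ x in a..b, f' x t) (Ici 0) t := by
  have hc : Continuous fun s => ∫ x in a..b, f' x s :=
    intervalIntegral.continuous_parametric_intervalIntegral_of_continuous'
      (f := fun s x => f' x s) (by fun_prop) a b
  have heq : ∀ s, 0 ≤ s → ∫ x in a..b, f x s
      = (∫ x in a..b, f x 0) + ∫ r in (0:ℝ)..s, ∫ x in a..b, f' x r := by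
    intro s hs
    have h1 : ∀ x ∈ uIcc a b, f x s = f x 0 + ∫ r in (0:ℝ)..s, f' x r := by
      intro x hx
      rw [uIcc_of_le hab] at hx
      rw [integral_eq_sub_of_hasDerivWithinAt_Ici hs (hf x hx)
        (Continuous.intervalIntegrable (by fun_prop) _ _)]
      ring
    have hc2 : Continuous fun x => ∫ r in (0:ℝ)..s, f' x r :=
      intervalIntegral.continuous_parametric_intervalIntegral_of_continuous' hf' 0 s
    rw [intervalIntegral.integral_congr h1,
      intervalIntegral.integral_add hf₀ (hc2.intervalIntegrable _ _)]
    congr 1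
    refine intervalIntegral_intervalIntegral_swap
      (IntegrableOn.mono_set ?_ (prod_mono uIoc_subset_uIcc uIoc_subset_uIcc))
    exact hf'.continuousOn.integrableOn_compact (isCompact_uIcc.prod isCompact_uIcc)
  have hd : HasDerivAt (fun s => (∫ x in a..b, f x 0) + ∫ r in (0:ℝ)..s, ∫ x in a..b, f' x r)
      (∫ x in a..b, f' x t) t :=
    ((hc.integral_hasStrictDerivAt 0 t).hasDerivAt).const_add _
  exact hd.hasDerivWithinAt.congr heq (heq t ht)

/-- A quadratic increment bound: `(f x - f y)² ≤ ∫ a · ∫ b` if `f'² ≤ a b`. -/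
theorem sq_sub_le_integral_mul_integral {f f' a b : ℝ → ℝ} (ha : Continuous a) (hb : Continuous b)
    (ha0 : ∀ x ∈ Icc (0:ℝ) 1, 0 ≤ a x) (hb0 : ∀ x ∈ Icc (0:ℝ) 1, 0 ≤ b x) (hf' : Continuous f')
    (hf : ∀ x ∈ Icc (0:ℝ) 1, HasDerivWithinAt f (f' x) (Icc 0 1) x)
    (hab : ∀ x ∈ Icc (0:ℝ) 1, f' x ^ 2 ≤ a x * b x) {x y : ℝ} (hx : x ∈ Icc (0:ℝ) 1)
    (hy : y ∈ Icc (0:ℝ) 1) :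
    (f x - f y) ^ 2 ≤ (∫ z in (0:ℝ)..1, a z) * ∫ z in (0:ℝ)..1, b z := by
  have h1 : |f x - f y| ≤ ∫ z in (0:ℝ)..1, |f' z| := by
    wlog hxy : y ≤ x generalizing x y
    · rw [abs_sub_comm]
      exact this hy hx (le_of_not_ge hxy)
    rw [← integral_eq_sub_of_hasDerivWithinAt_Icc hy.1 hxy hx.2 hf (hf'.intervalIntegrable _ _)]
    refine (intervalIntegral.abs_integral_le_integral_abs hxy).trans ?_
    exact intervalIntegral.integral_mono_interval hy.1 hxy hx.2
      (Eventually.of_forall fun z => abs_nonneg (f' z)) (hf'.abs.intervalIntegrable _ _)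
  have hA : 0 ≤ ∫ z in (0:ℝ)..1, a z := intervalIntegral.integral_nonneg zero_le_one ha0
  have hB : 0 ≤ ∫ z in (0:ℝ)..1, b z := intervalIntegral.integral_nonneg zero_le_one hb0
  have h2 : ∀ s : ℝ, 0 ≤ (∫ z in (0:ℝ)..1, a z) * (s * s) + (-(2 * |f x - f y|)) * s
      + ∫ z in (0:ℝ)..1, b z := by
    intro s
    rcases le_or_gt s 0 with hs | hs
    · have := mul_nonneg hA (mul_self_nonneg s)
      have := mul_nonneg (abs_nonneg (f x - f y)) (neg_nonneg.2 hs)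
      linarith
    have h3 : ∫ z in (0:ℝ)..1, 2 * s * |f' z| ≤ ∫ z in (0:ℝ)..1, (s * s * a z + b z) := by
      refine intervalIntegral.integral_mono_on zero_le_one
        (Continuous.intervalIntegrable (by fun_prop) _ _)
        (Continuous.intervalIntegrable (by fun_prop) _ _) fun z hz => ?_
      refine abs_le_of_sq_le_sq' ?_ (add_nonneg (mul_nonneg (mul_self_nonneg s) (ha0 z hz))
        (hb0 z hz)) |>.2
      rw [mul_pow, sq_abs]
      nlinarith [mul_le_mul_of_nonneg_left (hab z hz) (sq_nonneg (2 * s)),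
        sq_nonneg (s * s * a z - b z)]
    rw [intervalIntegral.integral_const_mul, intervalIntegral.integral_add
      (Continuous.intervalIntegrable (by fun_prop) _ _)
      (Continuous.intervalIntegrable (by fun_prop) _ _), intervalIntegral.integral_const_mul] at h3
    nlinarith [mul_le_mul_of_nonneg_left h1 hs.le]
  have h4 := discrim_le_zero h2
  rw [discrim, neg_sq, mul_pow, sq_abs] at h4
  linarith

/-- Monotonicity of the integral over `[0,1]` of continuous functions. -/
theorem integral_unitInterval_mono {f g : ℝ → ℝ} (hf : Continuous f) (hg : Continuous g)
    (h : ∀ x ∈ Icc (0:ℝ) 1, f x ≤ g x) : ∫ x in (0:ℝ)..1, f x ≤ ∫ x in (0:ℝ)..1, g x :=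
  intervalIntegral.integral_mono_on zero_le_one (hf.intervalIntegrable _ _)
    (hg.intervalIntegrable _ _) h

/-- A continuous function on `[0,1]` is somewhere at most its integral. -/
theorem exists_le_of_integral_le {f : ℝ → ℝ} {c : ℝ} (hf : Continuous f)
    (h : ∫ x in (0:ℝ)..1, f x ≤ c) : ∃ x ∈ Icc (0:ℝ) 1, f x ≤ c := by
  obtain ⟨x, hx, hmin⟩ := isCompact_Icc.exists_isMinOn (nonempty_Icc.2 zero_le_one)
    (hf.continuousOn (s := Icc (0:ℝ) 1))
  refine ⟨x, hx, le_trans ?_ h⟩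
  have := integral_unitInterval_mono (f := fun _ => f x) continuous_const hf (fun y hy => hmin hy)
  simpa using this

namespace NSSol

/-- A solution whose fields have been extended to jointly continuous functions on the whole plane,
with positive specific volume and temperature. -/
structure IsGlobal (S : NSSol) : Prop where
  u : Continuous (Function.uncurry S.u)
  v : Continuous (Function.uncurry S.v)
  θ : Continuous (Function.uncurry S.θ)
  vx : Continuous (Function.uncurry S.vx)
  vt : Continuous (Function.uncurry S.vt)
  θx : Continuous (Function.uncurry S.θx)
  θt : Continuous (Function.uncurry S.θt)
  u_pos : ∀ x t, 0 < S.u x t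
  θ_pos : ∀ x t, 0 < S.θ x t

/-- The stress `σ = (v_x - θ)/u`. -/
noncomputable def stress (S : NSSol) (x t : ℝ) : ℝ := (S.vx x t - S.θ x t) / S.u x t

/-- The heat flux `θ^β θ_x / u`. -/
noncomputable def flux (S : NSSol) (x t : ℝ) : ℝ := S.θ x t ^ S.β * S.θx x t / S.u x t

/-- The weighted heat dissipation `∫₀¹ θ^β θ_x² dx`. -/
noncomputable def heat (S : NSSol) (t : ℝ) : ℝ :=
  ∫ x in (0:ℝ)..1, S.θ x t ^ S.β * (S.θx x t) ^ 2

/-- The defect `∫₀¹ (v_x - θ)² dx`. -/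
noncomputable def defect (S : NSSol) (t : ℝ) : ℝ := ∫ x in (0:ℝ)..1, (S.vx x t - S.θ x t) ^ 2

/-- The mean temperature `∫₀¹ θ dx`. -/
noncomputable def mean (S : NSSol) (t : ℝ) : ℝ := ∫ x in (0:ℝ)..1, S.θ x t

theorem stress_zero (S : NSSol) {t : ℝ} (ht : 0 ≤ t) : S.stress 0 t = 0 := S.bc0 t ht

theorem stress_one (S : NSSol) {t : ℝ} (ht : 0 ≤ t) : S.stress 1 t = 0 := S.bc1 t ht

theorem flux_zero (S : NSSol) {t : ℝ} (ht : 0 ≤ t) : S.flux 0 t = 0 := by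
  simp [flux, S.bcθ0 t ht]

theorem flux_one (S : NSSol) {t : ℝ} (ht : 0 ≤ t) : S.flux 1 t = 0 := by
  simp [flux, S.bcθ1 t ht]

theorem hasDerivWithinAt_stress (S : NSSol) {x t : ℝ} (hx : x ∈ Icc (0:ℝ) 1) (ht : 0 ≤ t) :
    HasDerivWithinAt (fun y => S.stress y t) (S.vt x t) (Icc 0 1) x := S.momentum x hx t ht

theorem hasDerivWithinAt_flux (S : NSSol) {x t : ℝ} (hx : x ∈ Icc (0:ℝ) 1) (ht : 0 ≤ t) :
    HasDerivWithinAt (fun y => S.flux y t) (S.θt x t - S.stress x t * S.vx x t) (Icc 0 1) x := by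
  refine (S.energyEq x hx t ht).congr_deriv ?_
  have := (S.hu_pos x hx t ht).ne'
  rw [stress]
  field_simp
  ring

namespace IsGlobal

variable {S : NSSol}

theorem continuous_stress (h : S.IsGlobal) : Continuous (Function.uncurry S.stress) := by
  have := h.u; have := h.θ; have := h.vx
  have : ∀ p : ℝ × ℝ, S.u p.1 p.2 ≠ 0 := fun p => (h.u_pos _ _).ne'
  change Continuous fun p : ℝ × ℝ => (S.vx p.1 p.2 - S.θ p.1 p.2) / S.u p.1 p.2
  fun_prop (disch := assumption)

theorem continuous_rpow (h : S.IsGlobal) (a : ℝ) :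
    Continuous (Function.uncurry fun x t => S.θ x t ^ a) :=
  h.θ.rpow_const fun p => Or.inl (h.θ_pos p.1 p.2).ne'

theorem continuous_flux (h : S.IsGlobal) : Continuous (Function.uncurry S.flux) := by
  have h1 := h.continuous_rpow S.β
  exact (h1.mul h.θx).div h.u fun p => (h.u_pos p.1 p.2).ne'

theorem continuous_heat (h : S.IsGlobal) : Continuous S.heat := by
  have h1 := h.continuous_rpow S.β
  refine intervalIntegral.continuous_parametric_intervalIntegral_of_continuous'
    (f := fun t x => S.θ x t ^ S.β * (S.θx x t) ^ 2) ?_ 0 1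
  exact (h1.comp continuous_swap).mul ((h.θx.comp continuous_swap).pow 2)

theorem continuous_defect (h : S.IsGlobal) : Continuous S.defect := by
  have := h.vx; have := h.θ
  exact intervalIntegral.continuous_parametric_intervalIntegral_of_continuous'
    (f := fun t x => (S.vx x t - S.θ x t) ^ 2) (by fun_prop) 0 1

theorem continuous_heatDensity (h : S.IsGlobal) : Continuous (Function.uncurry fun x t =>
    S.θ x t ^ S.β * (S.θx x t) ^ 2 / (S.u x t * (S.θ x t) ^ 2)) :=
  ((h.continuous_rpow S.β).mul (h.θx.pow 2)).div (h.u.mul (h.θ.pow 2)) fun p =>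
    (mul_pos (h.u_pos p.1 p.2) (pow_pos (h.θ_pos p.1 p.2) 2)).ne'

theorem continuous_defectDensity (h : S.IsGlobal) : Continuous (Function.uncurry fun x t =>
    (S.vx x t - S.θ x t) ^ 2 / (S.u x t * S.θ x t)) :=
  ((h.vx.sub h.θ).pow 2).div (h.u.mul h.θ) fun p =>
    (mul_pos (h.u_pos p.1 p.2) (h.θ_pos p.1 p.2)).ne'

theorem continuous_V (h : S.IsGlobal) : Continuous S.V :=
  intervalIntegral.continuous_parametric_intervalIntegral_of_continuous' (f := fun t x =>
    S.θ x t ^ S.β * (S.θx x t) ^ 2 / (S.u x t * (S.θ x t) ^ 2)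
      + (S.vx x t - S.θ x t) ^ 2 / (S.u x t * S.θ x t))
    ((h.continuous_heatDensity.comp continuous_swap).fun_add
      (h.continuous_defectDensity.comp continuous_swap)) 0 1

theorem heatDensity_nonneg (h : S.IsGlobal) (x t : ℝ) :
    0 ≤ S.θ x t ^ S.β * (S.θx x t) ^ 2 / (S.u x t * (S.θ x t) ^ 2) := by
  have := h.u_pos x t; have := h.θ_pos x t
  positivity

theorem defectDensity_nonneg (h : S.IsGlobal) (x t : ℝ) :
    0 ≤ (S.vx x t - S.θ x t) ^ 2 / (S.u x t * S.θ x t) := by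
  have := h.u_pos x t; have := h.θ_pos x t
  positivity

theorem V_eq_add (h : S.IsGlobal) (t : ℝ) : S.V t =
    (∫ x in (0:ℝ)..1, S.θ x t ^ S.β * (S.θx x t) ^ 2 / (S.u x t * (S.θ x t) ^ 2))
      + ∫ x in (0:ℝ)..1, (S.vx x t - S.θ x t) ^ 2 / (S.u x t * S.θ x t) := by
  have h1 := h.continuous_heatDensity.comp (Continuous.prodMk_left t)
  have h2 := h.continuous_defectDensity.comp (Continuous.prodMk_left t)
  exact intervalIntegral.integral_add (h1.intervalIntegrable 0 1) (h2.intervalIntegrable 0 1)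

theorem integral_heatDensity_le_V (h : S.IsGlobal) (t : ℝ) :
    ∫ x in (0:ℝ)..1, S.θ x t ^ S.β * (S.θx x t) ^ 2 / (S.u x t * (S.θ x t) ^ 2) ≤ S.V t := by
  rw [h.V_eq_add]
  exact le_add_of_nonneg_right (intervalIntegral.integral_nonneg zero_le_one
    fun x _ => h.defectDensity_nonneg x t)

theorem integral_defectDensity_le_V (h : S.IsGlobal) (t : ℝ) :
    ∫ x in (0:ℝ)..1, (S.vx x t - S.θ x t) ^ 2 / (S.u x t * S.θ x t) ≤ S.V t := by
  rw [h.V_eq_add]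
  exact le_add_of_nonneg_left (intervalIntegral.integral_nonneg zero_le_one
    fun x _ => h.heatDensity_nonneg x t)

theorem V_nonneg (h : S.IsGlobal) (t : ℝ) : 0 ≤ S.V t :=
  (intervalIntegral.integral_nonneg zero_le_one
    fun x _ => h.heatDensity_nonneg x t).trans (h.integral_heatDensity_le_V t)

theorem heat_nonneg (h : S.IsGlobal) (t : ℝ) : 0 ≤ S.heat t :=
  intervalIntegral.integral_nonneg zero_le_one fun x _ =>
    mul_nonneg (rpow_nonneg (h.θ_pos x t).le _) (sq_nonneg _)

/-- The stress is the time derivative of the velocity potential. -/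
theorem hasDerivWithinAt_potential (h : S.IsGlobal) {x t : ℝ} (hx : x ∈ Icc (0:ℝ) 1) (ht : 0 ≤ t) :
    HasDerivWithinAt (fun s => ∫ y in (0:ℝ)..x, S.v y s) (S.stress x t) (Ici 0) t := by
  have hv := h.v; have hvt := h.vt
  have h1 : ∫ y in (0:ℝ)..x, S.vt y t = S.stress x t - S.stress 0 t :=
    integral_eq_sub_of_hasDerivWithinAt_Icc le_rfl hx.1 hx.2
      (fun y hy => S.hasDerivWithinAt_stress hy ht) (Continuous.intervalIntegrable (by fun_prop) _ _)
  rw [S.stress_zero ht, sub_zero] at h1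
  rw [← h1]
  exact hasDerivWithinAt_intervalIntegral hx.1 hvt
    (Continuous.intervalIntegrable (by fun_prop) _ _)
    (fun y hy s hs => S.hvt y ⟨hy.1, hy.2.trans hx.2⟩ s hs) ht

/-- Conservation of energy. -/
theorem energy_eq (h : S.IsGlobal) {t : ℝ} (ht : 0 ≤ t) :
    ∫ x in (0:ℝ)..1, ((S.v x t) ^ 2 / 2 + S.θ x t) = S.E₀ := by
  have := h.v; have := h.vt; have := h.θ; have := h.θt
  have hd : ∀ s, 0 ≤ s → HasDerivWithinAt
      (fun r => ∫ x in (0:ℝ)..1, ((S.v x r) ^ 2 / 2 + S.θ x r)) 0 (Ici 0) s := by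
    intro s hs
    have h1 : ∫ x in (0:ℝ)..1, (S.v x s * S.vt x s + S.θt x s)
        = (S.v 1 s * S.stress 1 s + S.flux 1 s) - (S.v 0 s * S.stress 0 s + S.flux 0 s) := by
      refine integral_eq_sub_of_hasDerivWithinAt_Icc
        (f := fun x => S.v x s * S.stress x s + S.flux x s) le_rfl zero_le_one le_rfl
        (fun x hx => ?_) (Continuous.intervalIntegrable (by fun_prop) _ _)
      refine (((S.hvx x hx s hs).fun_mul (S.hasDerivWithinAt_stress hx hs)).fun_add
        (S.hasDerivWithinAt_flux hx hs)).congr_deriv ?_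
      ring
    rw [S.stress_zero hs, S.stress_one hs, S.flux_zero hs, S.flux_one hs] at h1
    simp only [mul_zero, add_zero, sub_zero] at h1
    refine HasDerivWithinAt.congr_deriv ?_ h1
    refine hasDerivWithinAt_intervalIntegral (f := fun x r => (S.v x r) ^ 2 / 2 + S.θ x r)
      (f' := fun x r => S.v x r * S.vt x r + S.θt x r) zero_le_one (by fun_prop)
      (Continuous.intervalIntegrable (by fun_prop) _ _) (fun x hx r hr => ?_) hs
    refine ((((S.hvt x hx r hr).fun_pow 2).div_const 2).fun_add (S.hθt x hx r hr)).congr_deriv ?_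
    norm_num
    ring
  have := integral_eq_sub_of_hasDerivWithinAt_Ici ht hd
    (continuous_const.intervalIntegrable _ _)
  simp only [intervalIntegral.integral_zero] at this
  rw [E₀]
  linarith

theorem mean_le (h : S.IsGlobal) {t : ℝ} (ht : 0 ≤ t) : S.mean t ≤ S.E₀ := by
  have := h.v; have := h.θ
  rw [← h.energy_eq ht]
  exact integral_unitInterval_mono (by fun_prop) (by fun_prop) fun x _ => by
    have := sq_nonneg (S.v x t); linarith

theorem mean_pos (h : S.IsGlobal) (t : ℝ) : 0 < S.mean t := by
  have := h.θ
  exact intervalIntegral.intervalIntegral_pos_of_pos (Continuous.intervalIntegrable (by fun_prop) _ _)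
    (fun x => h.θ_pos x t) one_pos

theorem E₀_pos (h : S.IsGlobal) : 0 < S.E₀ := (h.mean_pos 0).trans_le (h.mean_le le_rfl)

theorem integral_abs_v_le (h : S.IsGlobal) {t : ℝ} (ht : 0 ≤ t) :
    ∫ x in (0:ℝ)..1, |S.v x t| ≤ S.E₀ + 1 := by
  have := h.v; have := h.θ
  have h1 : ∫ x in (0:ℝ)..1, ((S.v x t) ^ 2 / 2 + S.θ x t + 1) = S.E₀ + 1 := by
    rw [intervalIntegral.integral_add (Continuous.intervalIntegrable (by fun_prop) _ _)
      (Continuous.intervalIntegrable (by fun_prop) _ _), h.energy_eq ht]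
    simp
  rw [← h1]
  refine integral_unitInterval_mono (by fun_prop) (by fun_prop) fun x _ => ?_
  have := h.θ_pos x t
  nlinarith [sq_nonneg (|S.v x t| - 1), sq_abs (S.v x t)]

theorem abs_potential_le (h : S.IsGlobal) {x t : ℝ} (hx : x ∈ Icc (0:ℝ) 1) (ht : 0 ≤ t) :
    |∫ y in (0:ℝ)..x, S.v y t| ≤ S.E₀ + 1 := by
  have := h.v
  refine (intervalIntegral.abs_integral_le_integral_abs hx.1).trans
    (le_trans ?_ (h.integral_abs_v_le ht))
  exact intervalIntegral.integral_mono_interval le_rfl hx.1 hx.2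
    (Eventually.of_forall fun z => abs_nonneg (S.v z t))
    (Continuous.intervalIntegrable (by fun_prop) _ _)

theorem abs_moment_le (h : S.IsGlobal) {t : ℝ} (ht : 0 ≤ t) :
    |∫ x in (0:ℝ)..1, (1 - x) * S.v x t| ≤ S.E₀ + 1 := by
  have := h.v
  refine (intervalIntegral.abs_integral_le_integral_abs zero_le_one).trans
    (le_trans ?_ (h.integral_abs_v_le ht))
  refine integral_unitInterval_mono (by fun_prop) (by fun_prop) fun x hx => ?_
  rw [abs_mul]
  refine mul_le_of_le_one_left (abs_nonneg _) ?_
  rw [abs_le]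
  constructor <;> linarith [hx.1, hx.2]

/-- The entropy identity. -/
theorem hasDerivWithinAt_entropy (h : S.IsGlobal) {t : ℝ} (ht : 0 ≤ t) :
    HasDerivWithinAt (fun s => (∫ x in (0:ℝ)..1, log (S.θ x s))
      - ∫ x in (0:ℝ)..1, (1 - x) * S.v x s) (S.V t) (Ici 0) t := by
  have hv := h.v; have hvt := h.vt; have hθ := h.θ; have hθt := h.θt
  have hσ := h.continuous_stress
  have hne : ∀ p : ℝ × ℝ, S.θ p.1 p.2 ≠ 0 := fun p => (h.θ_pos _ _).ne'
  have hne' : ∀ t x : ℝ, S.θ x t ≠ 0 := fun t x => (h.θ_pos _ _).ne'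
  have hne'' : ∀ x : ℝ, S.θ x t ≠ 0 := fun x => (h.θ_pos _ _).ne'
  have hq : Continuous (Function.uncurry fun x s => S.θt x s / S.θ x s) :=
    hθt.div hθ fun p => hne p
  have hlog : HasDerivWithinAt (fun s => ∫ x in (0:ℝ)..1, log (S.θ x s))
      (∫ x in (0:ℝ)..1, S.θt x t / S.θ x t) (Ici 0) t := by
    refine hasDerivWithinAt_intervalIntegral (f := fun x s => log (S.θ x s)) zero_le_one hq
      (Continuous.intervalIntegrable (Continuous.log (by fun_prop) (hne' 0)) _ _)
      (fun x hx s hs => ?_) ht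
    exact (S.hθt x hx s hs).log (h.θ_pos x s).ne'
  have hmom : HasDerivWithinAt (fun s => ∫ x in (0:ℝ)..1, (1 - x) * S.v x s)
      (∫ x in (0:ℝ)..1, (1 - x) * S.vt x t) (Ici 0) t :=
    hasDerivWithinAt_intervalIntegral (f := fun x s => (1 - x) * S.v x s)
      (f' := fun x s => (1 - x) * S.vt x s) zero_le_one (by fun_prop)
      (Continuous.intervalIntegrable (by fun_prop) _ _)
      (fun x hx s hs => (S.hvt x hx s hs).const_mul (1 - x)) ht
  have h2 : ∫ x in (0:ℝ)..1, ((1 - x) * S.vt x t - S.stress x t)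
      = (1 - 1) * S.stress 1 t - (1 - 0) * S.stress 0 t := by
    refine integral_eq_sub_of_hasDerivWithinAt_Icc (f := fun x => (1 - x) * S.stress x t)
      le_rfl zero_le_one le_rfl (fun x hx => ?_) (Continuous.intervalIntegrable (by fun_prop) _ _)
    refine (((hasDerivWithinAt_id x _).const_sub 1).fun_mul
      (S.hasDerivWithinAt_stress hx ht)).congr_deriv ?_
    simp only [id_eq]
    ring
  rw [S.stress_zero ht, sub_self, zero_mul, mul_zero, sub_self,
    intervalIntegral.integral_sub (Continuous.intervalIntegrable (by fun_prop) _ _)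
      (Continuous.intervalIntegrable (by fun_prop) _ _)] at h2
  have c1 : Continuous fun x => S.θ x t ^ S.β * (S.θx x t) ^ 2 / (S.u x t * (S.θ x t) ^ 2)
      + (S.vx x t - S.θ x t) ^ 2 / (S.u x t * S.θ x t) :=
    (h.continuous_heatDensity.comp (Continuous.prodMk_left t)).fun_add
      (h.continuous_defectDensity.comp (Continuous.prodMk_left t))
  have c3 : Continuous fun x => S.θt x t / S.θ x t := by fun_prop (disch := assumption)
  have h3 : ∫ x in (0:ℝ)..1, (S.θt x t / S.θ x t - S.stress x t
      - (S.θ x t ^ S.β * (S.θx x t) ^ 2 / (S.u x t * (S.θ x t) ^ 2)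
      + (S.vx x t - S.θ x t) ^ 2 / (S.u x t * S.θ x t)))
      = S.flux 1 t / S.θ 1 t - S.flux 0 t / S.θ 0 t := by
    refine integral_eq_sub_of_hasDerivWithinAt_Icc (f := fun x => S.flux x t / S.θ x t)
      le_rfl zero_le_one le_rfl (fun x hx => ?_)
      (Continuous.intervalIntegrable (Continuous.sub (by fun_prop) c1) _ _)
    refine ((S.hasDerivWithinAt_flux hx ht).fun_div (S.hθx x hx t ht)
      (h.θ_pos x t).ne').congr_deriv ?_
    have := (h.θ_pos x t).ne'; have := (h.u_pos x t).ne'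
    rw [stress, flux]
    field_simp
    ring
  rw [intervalIntegral.integral_sub (Continuous.intervalIntegrable (by fun_prop) _ _)
      (c1.intervalIntegrable _ _), intervalIntegral.integral_sub
      (Continuous.intervalIntegrable (by fun_prop) _ _)
      (Continuous.intervalIntegrable (by fun_prop) _ _), S.flux_zero ht, S.flux_one ht,
      zero_div, zero_div, sub_self] at h3
  refine (hlog.fun_sub hmom).congr_deriv ?_
  rw [V]
  linarith

/-- The dissipation is integrable in time and the entropy is bounded below. -/
theorem exists_entropy_bounds (h : S.IsGlobal) : ∃ K > 0, ∃ L : ℝ, ∀ t, 0 ≤ t →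
    (∫ s in (0:ℝ)..t, S.V s) ≤ K ∧ -L ≤ ∫ x in (0:ℝ)..1, log (S.θ x t) := by
  have hθ := h.θ
  have key : ∀ t, 0 ≤ t → ∫ s in (0:ℝ)..t, S.V s = ((∫ x in (0:ℝ)..1, log (S.θ x t))
      - ∫ x in (0:ℝ)..1, (1 - x) * S.v x t) - ((∫ x in (0:ℝ)..1, log (S.θ x 0))
      - ∫ x in (0:ℝ)..1, (1 - x) * S.v x 0) := fun t ht =>
    integral_eq_sub_of_hasDerivWithinAt_Ici ht (fun s hs => h.hasDerivWithinAt_entropy hs)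
      (h.continuous_V.intervalIntegrable _ _)
  have hE := h.E₀_pos
  refine ⟨S.E₀ + 2 * (S.E₀ + 1) + |∫ x in (0:ℝ)..1, log (S.θ x 0)|, by positivity,
    2 * (S.E₀ + 1) - ∫ x in (0:ℝ)..1, log (S.θ x 0), fun t ht => ?_⟩
  have h1 : ∫ x in (0:ℝ)..1, log (S.θ x t) ≤ S.mean t := by
    refine integral_unitInterval_mono (Continuous.log (by fun_prop) fun x => (h.θ_pos x t).ne')
      (by fun_prop) fun x _ => ?_
    linarith [log_le_sub_one_of_pos (h.θ_pos x t)]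
  have h2 := h.mean_le ht
  have h3 := abs_le.1 (h.abs_moment_le ht)
  have h4 := abs_le.1 (h.abs_moment_le (le_refl (0:ℝ)))
  have h5 : 0 ≤ ∫ s in (0:ℝ)..t, S.V s :=
    intervalIntegral.integral_nonneg ht fun s _ => h.V_nonneg s
  have h6 := neg_abs_le (∫ x in (0:ℝ)..1, log (S.θ x 0))
  rw [key t ht] at h5 ⊢
  constructor <;> linarith [h3.1, h3.2, h4.1, h4.2]

end IsGlobal

end NSSol

theorem le_one_add_rpow {y q β : ℝ} (hy : 0 < y) (hβ : 0 ≤ β) (hq : 0 ≤ q) :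
    y ^ q ≤ 1 + y ^ (q + β) := by
  rcases le_total y 1 with h1 | h1
  · have := rpow_le_one hy.le h1 hq
    have := rpow_nonneg hy.le (q + β)
    linarith
  · have := rpow_le_rpow_of_exponent_le h1 (le_add_of_nonneg_right hβ : q ≤ q + β)
    linarith

namespace NSSol.IsGlobal

variable {S : NSSol}

theorem hasDerivWithinAt_rpow (h : S.IsGlobal) (p : ℝ) {x t : ℝ} (hx : x ∈ Icc (0:ℝ) 1)
    (ht : 0 ≤ t) : HasDerivWithinAt (fun y => S.θ y t ^ p)
      (p * (S.θ x t ^ (p - 1) * S.θx x t)) (Icc 0 1) x := by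
  refine ((S.hθx x hx t ht).rpow_const (p := p) (Or.inl (h.θ_pos x t).ne')).congr_deriv ?_
  ring

theorem continuous_rpow_slice (h : S.IsGlobal) (p t : ℝ) : Continuous fun x => S.θ x t ^ p :=
  (h.continuous_rpow p).comp (Continuous.prodMk_left t)

/-- Oscillation of a power of the temperature, controlled by the dissipation. -/
theorem sq_rpow_sub_le_V (h : S.IsGlobal) (p : ℝ) {x y t : ℝ} (hx : x ∈ Icc (0:ℝ) 1)
    (hy : y ∈ Icc (0:ℝ) 1) (ht : 0 ≤ t) : (S.θ x t ^ p - S.θ y t ^ p) ^ 2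
      ≤ S.V t * ∫ z in (0:ℝ)..1, p ^ 2 * (S.u z t * S.θ z t ^ (2 * p - S.β)) := by
  have hu := h.u; have hθx := h.θx
  have c1 := h.continuous_rpow_slice (p - 1) t
  have c2 := h.continuous_rpow_slice (2 * p - S.β) t
  have hb0 : ∀ z, 0 ≤ p ^ 2 * (S.u z t * S.θ z t ^ (2 * p - S.β)) := fun z =>
    mul_nonneg (sq_nonneg p) (mul_nonneg (h.u_pos z t).le (rpow_nonneg (h.θ_pos z t).le _))
  refine (sq_sub_le_integral_mul_integral (f := fun z => S.θ z t ^ p)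
    (h.continuous_heatDensity.comp (Continuous.prodMk_left t))
    (continuous_const.mul (Continuous.mul (by fun_prop) c2))
    (fun z _ => h.heatDensity_nonneg z t) (fun z _ => hb0 z)
    (continuous_const.mul (c1.mul (by fun_prop)))
    (fun z hz => h.hasDerivWithinAt_rpow p hz ht) (fun z hz => le_of_eq ?_) hx hy).trans
    (mul_le_mul_of_nonneg_right (h.integral_heatDensity_le_V t)
      (intervalIntegral.integral_nonneg zero_le_one fun z _ => hb0 z))
  have hθ := h.θ_pos z t
  have huz := (h.u_pos z t).ne'
  have e1 : S.θ z t ^ (2 * p - S.β) * S.θ z t ^ S.β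
      = (S.θ z t ^ (p - 1)) ^ 2 * S.θ z t ^ 2 := by
    rw [← rpow_add hθ, ← rpow_natCast (S.θ z t ^ (p - 1)) 2, ← rpow_mul hθ.le,
      ← rpow_natCast (S.θ z t) 2, ← rpow_add hθ]
    congr 1
    push_cast
    ring
  simp only [Function.comp_apply, Function.uncurry_apply_pair, Pi.mul_apply]
  generalize S.θ z t ^ (2 * p - S.β) = Q at e1 ⊢
  generalize S.θ z t ^ (p - 1) = P at e1 ⊢
  generalize S.θ z t ^ S.β = R at e1 ⊢
  field_simp
  linear_combination (-(S.θx z t) ^ 2 * p ^ 2) * e1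

/-- Oscillation of a power of the temperature, controlled by the weighted heat dissipation. -/
theorem sq_rpow_sub_le_heat (h : S.IsGlobal) (p : ℝ) {x y t : ℝ} (hx : x ∈ Icc (0:ℝ) 1)
    (hy : y ∈ Icc (0:ℝ) 1) (ht : 0 ≤ t) : (S.θ x t ^ p - S.θ y t ^ p) ^ 2
      ≤ S.heat t * ∫ z in (0:ℝ)..1, p ^ 2 * S.θ z t ^ (2 * p - 2 - S.β) := by
  have hθx := h.θx
  have c1 := h.continuous_rpow_slice (p - 1) t
  have c2 := h.continuous_rpow_slice (2 * p - 2 - S.β) t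
  have c3 := h.continuous_rpow_slice S.β t
  refine sq_sub_le_integral_mul_integral (f := fun z => S.θ z t ^ p)
    (c3.mul (by fun_prop)) (continuous_const.mul c2)
    (fun z _ => mul_nonneg (rpow_nonneg (h.θ_pos z t).le _) (sq_nonneg _))
    (fun z _ => mul_nonneg (sq_nonneg p) (rpow_nonneg (h.θ_pos z t).le _))
    (continuous_const.mul (c1.mul (by fun_prop)))
    (fun z hz => h.hasDerivWithinAt_rpow p hz ht) (fun z hz => le_of_eq ?_) hx hy
  have hθ := h.θ_pos z t
  have e1 : S.θ z t ^ S.β * S.θ z t ^ (2 * p - 2 - S.β) = (S.θ z t ^ (p - 1)) ^ 2 := by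
    rw [← rpow_add hθ, ← rpow_natCast (S.θ z t ^ (p - 1)) 2, ← rpow_mul hθ.le]
    congr 1
    push_cast
    ring
  simp only [Pi.mul_apply]
  linear_combination (-(S.θx z t) ^ 2 * p ^ 2) * e1

theorem exists_le_E₀ (h : S.IsGlobal) {t : ℝ} (ht : 0 ≤ t) :
    ∃ y ∈ Icc (0:ℝ) 1, S.θ y t ≤ S.E₀ := by
  have := h.θ
  exact exists_le_of_integral_le (by fun_prop) (h.mean_le ht)

/-- Powers of the temperature are controlled by their oscillation. -/
theorem rpow_le_of_sq_sub_le (h : S.IsGlobal) {p q B x t : ℝ} (hp : 0 ≤ p) (hq : 0 ≤ q)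
    (hpq : 2 * p = q + S.β) (ht : 0 ≤ t)
    (hB : ∀ y ∈ Icc (0:ℝ) 1, (S.θ x t ^ p - S.θ y t ^ p) ^ 2 ≤ B) :
    S.θ x t ^ q ≤ 1 + 2 * (S.E₀ ^ p) ^ 2 + 2 * B := by
  obtain ⟨y, hy, hyE⟩ := h.exists_le_E₀ ht
  have h1 := hB y hy
  have h2 : S.θ y t ^ p ≤ S.E₀ ^ p := rpow_le_rpow (h.θ_pos y t).le hyE hp
  have h3 : S.θ x t ^ (q + S.β) = (S.θ x t ^ p) ^ 2 := by
    rw [← rpow_natCast (S.θ x t ^ p) 2, ← rpow_mul (h.θ_pos x t).le, ← hpq]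
    congr 1
    push_cast
    ring
  have h4 := le_one_add_rpow (h.θ_pos x t) S.hβ.le hq
  have h5 := pow_le_pow_left₀ (rpow_nonneg (h.θ_pos y t).le p) h2 2
  rw [h3] at h4
  nlinarith [sq_nonneg (S.θ x t ^ p - 2 * S.θ y t ^ p)]

/-- Pointwise upper bound of the temperature in terms of the dissipation. -/
theorem exists_θ_le_V (h : S.IsGlobal) : ∃ K > 0, ∀ t, 0 ≤ t → ∀ M, 0 ≤ M →
    (∀ x ∈ Icc (0:ℝ) 1, S.u x t ≤ M) → ∀ x ∈ Icc (0:ℝ) 1, S.θ x t ≤ K * (1 + S.V t * M) := by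
  have hE := h.E₀_pos
  have hβ := S.hβ
  set p := (S.β + 1) / 2 with hp
  refine ⟨1 + 2 * (S.E₀ ^ p) ^ 2 + 2 * (p ^ 2 * S.E₀), by positivity, fun t ht M hM hu x hx => ?_⟩
  have hV := h.V_nonneg t
  have hint : ∫ z in (0:ℝ)..1, p ^ 2 * (S.u z t * S.θ z t ^ (2 * p - S.β))
      ≤ p ^ 2 * (M * S.E₀) := by
    have cu := h.u; have cθ := h.θ
    have e : 2 * p - S.β = 1 := by rw [hp]; ring
    simp only [e, rpow_one]
    rw [intervalIntegral.integral_const_mul]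
    refine mul_le_mul_of_nonneg_left ?_ (sq_nonneg p)
    refine (integral_unitInterval_mono (g := fun z => M * S.θ z t) (by fun_prop) (by fun_prop)
      fun z hz => mul_le_mul_of_nonneg_right (hu z hz) (h.θ_pos z t).le).trans ?_
    rw [intervalIntegral.integral_const_mul]
    exact mul_le_mul_of_nonneg_left (h.mean_le ht) hM
  have h1 := h.rpow_le_of_sq_sub_le (p := p) (q := 1) (x := x) (by positivity) zero_le_one
    (by rw [hp]; ring) ht fun y hy => (h.sq_rpow_sub_le_V p hx hy ht).trans
      (mul_le_mul_of_nonneg_left hint hV)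
  rw [rpow_one] at h1
  have h2 : 0 ≤ 2 * (S.E₀ ^ p) ^ 2 * (S.V t * M) := by positivity
  have h3 : 0 ≤ S.V t * M := by positivity
  have h4 : 0 ≤ p ^ 2 * S.E₀ := by positivity
  linarith

/-- Pointwise upper bound of the temperature in terms of the weighted heat dissipation. -/
theorem exists_sq_θ_le_heat (h : S.IsGlobal) : ∃ K > 0, ∀ t, 0 ≤ t →
    ∀ x ∈ Icc (0:ℝ) 1, S.θ x t ^ 2 ≤ K * (1 + S.heat t) := by
  have hE := h.E₀_pos
  have hβ := S.hβ
  set p := (S.β + 2) / 2 with hp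
  refine ⟨1 + 2 * (S.E₀ ^ p) ^ 2 + 2 * p ^ 2, by positivity, fun t ht x hx => ?_⟩
  have hD := h.heat_nonneg t
  have h1 := h.rpow_le_of_sq_sub_le (p := p) (q := 2) (x := x) (by positivity) zero_le_two
    (by rw [hp]; ring) ht fun y hy => h.sq_rpow_sub_le_heat p hx hy ht
  have e : 2 * p - 2 - S.β = 0 := by rw [hp]; ring
  simp only [e, rpow_zero, mul_one, intervalIntegral.integral_const, sub_zero, one_smul,
    rpow_two] at h1
  have h2 : 0 ≤ 2 * (S.E₀ ^ p) ^ 2 * S.heat t := by positivity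
  have h4 : 0 ≤ p ^ 2 := by positivity
  linarith

/-- The temperature is bounded below whenever the dissipation is small. -/
theorem exists_le_θ_of_V_le (h : S.IsGlobal) {M : ℝ} (hM : 0 < M) : ∃ δ > 0, ∃ c > 0,
    ∀ t, 0 ≤ t → (∀ x ∈ Icc (0:ℝ) 1, S.u x t ≤ M) → S.V t ≤ δ →
      ∀ x ∈ Icc (0:ℝ) 1, c ≤ S.θ x t := by
  obtain ⟨K, _, L, hL⟩ := h.exists_entropy_bounds
  have hβ := S.hβ
  set p := S.β / 2 with hp
  have hp0 : 0 < p := by positivity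
  set a := exp (-L) ^ p with ha
  have ha0 : 0 < a := by positivity
  refine ⟨(a / 2) ^ 2 / (p ^ 2 * M), by positivity, (a / 2) ^ p⁻¹, by positivity,
    fun t ht hu hV x hx => ?_⟩
  have cθ := h.θ
  obtain ⟨y, hy, hyL⟩ := exists_le_of_integral_le (f := fun x => -log (S.θ x t)) (c := L)
    (Continuous.neg (Continuous.log (by fun_prop) fun x => (h.θ_pos x t).ne')) (by
      rw [intervalIntegral.integral_neg]
      linarith [(hL t ht).2])
  have hya : a ≤ S.θ y t ^ p := by
    refine rpow_le_rpow (exp_pos _).le ?_ hp0.le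
    rw [← le_log_iff_exp_le (h.θ_pos y t)]
    linarith
  have hint : ∫ z in (0:ℝ)..1, p ^ 2 * (S.u z t * S.θ z t ^ (2 * p - S.β)) ≤ p ^ 2 * M := by
    have cu := h.u
    have e : 2 * p - S.β = 0 := by rw [hp]; ring
    simp only [e, rpow_zero, mul_one]
    rw [intervalIntegral.integral_const_mul]
    refine mul_le_mul_of_nonneg_left ?_ (sq_nonneg p)
    refine (integral_unitInterval_mono (g := fun _ => M) (by fun_prop) (by fun_prop)
      fun z hz => hu z hz).trans ?_
    simp
  have h1 : (S.θ x t ^ p - S.θ y t ^ p) ^ 2 ≤ (a / 2) ^ 2 := by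
    refine (h.sq_rpow_sub_le_V p hx hy ht).trans
      ((mul_le_mul_of_nonneg_left hint (h.V_nonneg t)).trans ?_)
    rwa [← le_div_iff₀ (by positivity)]
  have h2 := (abs_le_of_sq_le_sq' h1 (by positivity)).1
  rw [rpow_inv_le_iff_of_pos (by positivity) (h.θ_pos x t).le hp0]
  linarith

theorem hasDerivAt_integral_V (h : S.IsGlobal) (t : ℝ) :
    HasDerivAt (fun s => ∫ r in (0:ℝ)..s, S.V r) (S.V t) t :=
  (h.continuous_V.integral_hasStrictDerivAt 0 t).hasDerivAt

/-- Uniform upper bound of the specific volume. -/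
theorem exists_u_le (h : S.IsGlobal) : ∃ M > 0, ∀ t, 0 ≤ t → ∀ x ∈ Icc (0:ℝ) 1, S.u x t ≤ M := by
  obtain ⟨K, hK, L, hKL⟩ := h.exists_entropy_bounds
  obtain ⟨K₁, hK₁, hθle⟩ := h.exists_θ_le_V
  have hu := h.u
  have hE := h.E₀_pos
  set b := S.E₀ + 1 with hb
  obtain ⟨x₀, hx₀, hmax₀⟩ := isCompact_Icc.exists_isMaxOn (nonempty_Icc.2 zero_le_one)
    (Continuous.continuousOn (f := fun x => S.u x 0) (s := Icc (0:ℝ) 1) (by fun_prop))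
  set U := S.u x₀ 0 with hU
  have hU0 : 0 < U := h.u_pos _ _
  set l := 2 * (K₁ * exp (2 * b)) with hl
  have hl0 : 0 < l := by positivity
  set W : ℝ → ℝ := fun s => ∫ r in (0:ℝ)..s, S.V r with hW
  have hWd : ∀ s, HasDerivAt W (S.V s) s := h.hasDerivAt_integral_V
  have hWc : Continuous W := continuous_iff_continuousAt.2 fun s => (hWd s).continuousAt
  have hW0 : ∀ s, 0 ≤ s → 0 ≤ W s := fun s hs =>
    intervalIntegral.integral_nonneg hs fun r _ => h.V_nonneg r
  refine ⟨2 * exp (2 * b) * (U + K₁) * exp (l * K), by positivity, fun T hT x hx => ?_⟩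
  obtain ⟨⟨x₁, t₁⟩, hz, hmax⟩ := (isCompact_Icc.prod isCompact_Icc).exists_isMaxOn
    (⟨(x, T), hx, right_mem_Icc.2 hT⟩ : (Icc (0:ℝ) 1 ×ˢ Icc (0:ℝ) T).Nonempty)
    (Continuous.continuousOn (f := fun z : ℝ × ℝ => S.u z.1 z.2 * exp (-(l * W z.2)))
      (by fun_prop))
  obtain ⟨hx₁, ht₁⟩ : x₁ ∈ Icc (0:ℝ) 1 ∧ t₁ ∈ Icc (0:ℝ) T := hz
  set R := S.u x₁ t₁ * exp (-(l * W t₁)) with hR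
  have hR0 : 0 < R := mul_pos (h.u_pos _ _) (exp_pos _)
  have huR : ∀ y ∈ Icc (0:ℝ) 1, ∀ s ∈ Icc (0:ℝ) T, S.u y s ≤ R * exp (l * W s) := by
    intro y hy s hs
    have h1 : S.u y s * exp (-(l * W s)) ≤ R := hmax (show (y, s) ∈ _ from ⟨hy, hs⟩)
    rwa [exp_neg, ← div_eq_mul_inv, div_le_iff₀ (exp_pos _)] at h1
  have hY : R * exp (l * W t₁) = S.u x₁ t₁ := by
    rw [hR, mul_assoc, ← exp_add]
    simp
  set B : ℝ → ℝ := fun s => ∫ y in (0:ℝ)..x₁, S.v y s with hB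
  have hBle : ∀ s, 0 ≤ s → |B s| ≤ b := fun s hs => h.abs_potential_le hx₁ hs
  have hZ : ∀ s, 0 ≤ s → HasDerivWithinAt (fun s => S.u x₁ s * exp (s - B s))
      (exp (s - B s) * S.θ x₁ s) (Ici 0) s := by
    intro s hs
    refine ((S.hut x₁ hx₁ s hs).fun_mul (((hasDerivWithinAt_id s _).fun_sub
      (h.hasDerivWithinAt_potential hx₁ hs)).exp)).congr_deriv ?_
    have := S.mass x₁ hx₁ s hs
    have hne := (h.u_pos x₁ s).ne'
    simp only [id_eq, hB]
    rw [stress]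
    field_simp
    linear_combination this
  have hG : ∀ s, 0 ≤ s → HasDerivWithinAt
      (fun s => K₁ * exp b * (exp s + exp t₁ * (R * exp (l * W s) / l)))
      (K₁ * exp b * (exp s + exp t₁ * (R * (S.V s * exp (l * W s))))) (Ici 0) s := by
    intro s hs
    refine HasDerivAt.hasDerivWithinAt ?_
    refine (((hasDerivAt_exp s).fun_add (((((hWd s).const_mul l).exp.const_mul R).div_const
      l).const_mul (exp t₁))).const_mul (K₁ * exp b)).congr_deriv ?_
    field_simp
  have hcomp := sub_le_sub_of_hasDerivWithinAt_le ht₁.1 hZ hG fun s hs hst => by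
    have h1 := hθle s hs (R * exp (l * W s)) (by positivity)
      (fun y hy => huR y hy s ⟨hs, hst.trans ht₁.2⟩) x₁ hx₁
    have h2 : exp (s - B s) ≤ exp b * exp s := by
      rw [← exp_add, exp_le_exp]
      linarith [(abs_le.1 (hBle s hs)).1]
    have h3 : exp s ≤ exp t₁ := exp_le_exp.2 hst
    have hV := h.V_nonneg s
    calc exp (s - B s) * S.θ x₁ s
        ≤ (exp b * exp s) * (K₁ * (1 + S.V s * (R * exp (l * W s)))) :=
          mul_le_mul h2 h1 (h.θ_pos _ _).le (by positivity)
      _ = K₁ * exp b * (exp s + exp s * (R * (S.V s * exp (l * W s)))) := by ring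
      _ ≤ _ := by gcongr
  have h0 : S.u x₁ 0 ≤ U := hmax₀ hx₁
  have hB0 := abs_le.1 (hBle 0 le_rfl)
  have hB1 := abs_le.1 (hBle t₁ ht₁.1)
  have hZ0 : S.u x₁ 0 * exp (0 - B 0) ≤ U * exp b * exp t₁ := by
    rw [mul_assoc, ← exp_add]
    refine mul_le_mul h0 (exp_le_exp.2 ?_) (exp_pos _).le hU0.le
    linarith [ht₁.1, hB0.1]
  have hZ1 : S.u x₁ t₁ * (exp t₁ * exp (-b)) ≤ S.u x₁ t₁ * exp (t₁ - B t₁) := by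
    rw [← exp_add]
    refine mul_le_mul_of_nonneg_left (exp_le_exp.2 ?_) (h.u_pos _ _).le
    linarith [hB1.2]
  have hG0 : 0 ≤ K₁ * exp b * (exp 0 + exp t₁ * (R * exp (l * W 0) / l)) := by positivity
  have h4 : S.u x₁ t₁ * (exp t₁ * exp (-b))
      ≤ (U * exp b + K₁ * exp b * (1 + S.u x₁ t₁ / l)) * exp t₁ := by
    rw [hY] at hcomp
    linarith
  have h5 : S.u x₁ t₁ * exp (-b) ≤ U * exp b + K₁ * exp b * (1 + S.u x₁ t₁ / l) := by
    refine le_of_mul_le_mul_right ?_ (exp_pos t₁)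
    linarith
  have h6 : S.u x₁ t₁ ≤ 2 * exp (2 * b) * (U + K₁) := by
    have h7 := mul_le_mul_of_nonneg_right h5 (exp_pos b).le
    rw [mul_assoc, ← exp_add, neg_add_cancel, exp_zero, mul_one] at h7
    have e1 : exp (2 * b) = exp b * exp b := by rw [← exp_add]; ring_nf
    have e2 : K₁ * exp b * (S.u x₁ t₁ / l) * exp b = S.u x₁ t₁ / 2 := by
      rw [hl, e1]
      field_simp
    rw [e1]
    linarith
  have h8 : R ≤ S.u x₁ t₁ := by
    refine mul_le_of_le_one_right (h.u_pos _ _).le (exp_le_one_iff.2 ?_)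
    have := mul_nonneg hl0.le (hW0 t₁ ht₁.1)
    linarith
  refine (huR x hx T (right_mem_Icc.2 hT)).trans
    (mul_le_mul (h8.trans h6) (exp_le_exp.2 ?_) (exp_pos _).le (by positivity))
  exact mul_le_mul_of_nonneg_left (hKL T hT).1 hl0.le

/-- Uniform positive lower bound of the specific volume. -/
theorem exists_le_u (h : S.IsGlobal) : ∃ m > 0, ∀ t, 0 ≤ t → ∀ x ∈ Icc (0:ℝ) 1, m ≤ S.u x t := by
  obtain ⟨K, hK, L, hKL⟩ := h.exists_entropy_bounds
  obtain ⟨M, hM, huM⟩ := h.exists_u_le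
  obtain ⟨δ, hδ, c, hc, hθc⟩ := h.exists_le_θ_of_V_le hM
  have hu := h.u
  have hE := h.E₀_pos
  set b := S.E₀ + 1 with hb
  obtain ⟨x₀, hx₀, hmin₀⟩ := isCompact_Icc.exists_isMinOn (nonempty_Icc.2 zero_le_one)
    (Continuous.continuousOn (f := fun x => S.u x 0) (s := Icc (0:ℝ) 1) (by fun_prop))
  set U := S.u x₀ 0 with hU
  have hU0 : 0 < U := h.u_pos _ _
  set W : ℝ → ℝ := fun s => ∫ r in (0:ℝ)..s, S.V r with hW
  have hWd : ∀ s, HasDerivAt W (S.V s) s := h.hasDerivAt_integral_V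
  have hW0 : ∀ s, 0 ≤ s → 0 ≤ W s := fun s hs =>
    intervalIntegral.integral_nonneg hs fun r _ => h.V_nonneg r
  set a := min U (c / 2) with ha
  have ha0 : 0 < a := lt_min hU0 (by positivity)
  refine ⟨a * exp (-b) * exp (-b - K / δ), by positivity, fun T hT x hx => ?_⟩
  set B : ℝ → ℝ := fun s => ∫ y in (0:ℝ)..x, S.v y s with hB
  have hBle : ∀ s, 0 ≤ s → |B s| ≤ b := fun s hs => h.abs_potential_le hx hs
  have hQ : ∀ s, 0 ≤ s → HasDerivWithinAt (fun s => S.u x s * exp (W s / δ - B s))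
      (exp (W s / δ - B s) * (S.θ x s - S.u x s + S.V s / δ * S.u x s)) (Ici 0) s := by
    intro s hs
    refine ((S.hut x hx s hs).fun_mul ((((hWd s).div_const δ).hasDerivWithinAt.fun_sub
      (h.hasDerivWithinAt_potential hx hs)).exp)).congr_deriv ?_
    have := S.mass x hx s hs
    have hne := (h.u_pos x s).ne'
    simp only [hB]
    rw [stress]
    field_simp
    linear_combination δ * this
  have hQm : a * exp (-b) ≤ S.u x T * exp (W T / δ - B T) := by
    refine le_of_hasDerivWithinAt_pos_of_eq (f := fun s => S.u x s * exp (W s / δ - B s)) hT hQ ?_ fun s hs hsa => mul_pos (exp_pos _) ?_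
    · have hB0 := (abs_le.1 (hBle 0 le_rfl)).2
      have hW00 : W 0 = 0 := intervalIntegral.integral_same
      rw [hW00]
      refine mul_le_mul ((min_le_left _ _).trans (hmin₀ hx)) (exp_le_exp.2 ?_) (exp_pos _).le
        (h.u_pos _ _).le
      simp only [zero_div]
      linarith
    · have hus := h.u_pos x s
      have hV := h.V_nonneg s
      rcases le_or_gt (S.V s) δ with hVδ | hVδ
      · have h1 := hθc s hs (huM s hs) hVδ x hx
        have h2 : S.u x s * exp (-b) ≤ a * exp (-b) := by
          rw [← hsa]
          refine mul_le_mul_of_nonneg_left (exp_le_exp.2 ?_) hus.le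
          have := div_nonneg (hW0 s hs) hδ.le
          linarith [(abs_le.1 (hBle s hs)).2]
        have h3 := le_of_mul_le_mul_right h2 (exp_pos _)
        have h4 : a ≤ c / 2 := min_le_right _ _
        have : 0 ≤ S.V s / δ * S.u x s := by positivity
        linarith
      · have h1 : 1 * S.u x s ≤ S.V s / δ * S.u x s := by
          refine mul_le_mul_of_nonneg_right ?_ hus.le
          rw [one_le_div hδ]
          exact hVδ.le
        linarith [h.θ_pos x s]
  have hBT := (abs_le.1 (hBle T hT)).1
  have h5 : exp (W T / δ - B T) * exp (-b - K / δ) ≤ 1 := by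
    rw [← exp_add, exp_le_one_iff]
    have : W T / δ ≤ K / δ := div_le_div_of_nonneg_right (hKL T hT).1 hδ.le
    linarith
  calc a * exp (-b) * exp (-b - K / δ)
      ≤ S.u x T * exp (W T / δ - B T) * exp (-b - K / δ) :=
        mul_le_mul_of_nonneg_right hQm (exp_pos _).le
    _ = S.u x T * (exp (W T / δ - B T) * exp (-b - K / δ)) := by ring
    _ ≤ S.u x T := mul_le_of_le_one_right (h.u_pos _ _).le h5

end NSSol.IsGlobal

namespace NSSol

namespace IsGlobal

variable {S : NSSol}

theorem hasDerivWithinAt_mean (h : S.IsGlobal) {t : ℝ} (ht : 0 ≤ t) :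
    HasDerivWithinAt S.mean (∫ x in (0:ℝ)..1, S.θt x t) (Ici 0) t := by
  have := h.θ
  exact hasDerivWithinAt_intervalIntegral zero_le_one h.θt
    (Continuous.intervalIntegrable (by fun_prop) _ _) (fun x hx s hs => S.hθt x hx s hs) ht

theorem sq_mean_le (h : S.IsGlobal) (t : ℝ) :
    S.mean t ^ 2 ≤ ∫ x in (0:ℝ)..1, S.θ x t ^ 2 := by
  have hθ := h.θ
  have h1 := integral_unitInterval_mono (f := fun x => S.mean t * (2 * S.θ x t - S.mean t))
    (g := fun x => S.θ x t ^ 2) (by fun_prop) (by fun_prop) fun x _ => by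
      nlinarith [sq_nonneg (S.θ x t - S.mean t)]
  rw [intervalIntegral.integral_const_mul, intervalIntegral.integral_sub
    (Continuous.intervalIntegrable (by fun_prop) _ _)
    (Continuous.intervalIntegrable (by fun_prop) _ _), intervalIntegral.integral_const_mul] at h1
  change S.mean t * (2 * S.mean t - _) ≤ _ at h1
  rw [intervalIntegral.integral_const, sub_zero, one_smul] at h1
  linarith

/-- Evolution of the variance of the temperature. -/
theorem hasDerivWithinAt_variance (h : S.IsGlobal) {t : ℝ} (ht : 0 ≤ t) :
    HasDerivWithinAt (fun s => (∫ x in (0:ℝ)..1, S.θ x s ^ 2) / 2 - S.mean s ^ 2 / 2)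
      ((∫ x in (0:ℝ)..1, (S.θ x t - S.mean t) * (S.stress x t * S.vx x t))
        - ∫ x in (0:ℝ)..1, S.θx x t * S.flux x t) (Ici 0) t := by
  have hθ := h.θ; have hθt := h.θt; have hθx := h.θx; have hvx := h.vx
  have hσ := h.continuous_stress; have hF := h.continuous_flux
  have h1 : HasDerivWithinAt (fun s => ∫ x in (0:ℝ)..1, S.θ x s ^ 2)
      (∫ x in (0:ℝ)..1, 2 * (S.θ x t * S.θt x t)) (Ici 0) t := by
    refine hasDerivWithinAt_intervalIntegral (f := fun x s => S.θ x s ^ 2)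
      (f' := fun x s => 2 * (S.θ x s * S.θt x s)) zero_le_one (by fun_prop)
      (Continuous.intervalIntegrable (by fun_prop) _ _) (fun x hx s hs => ?_) ht
    refine ((S.hθt x hx s hs).fun_pow 2).congr_deriv ?_
    norm_num
    ring
  have h2 : ∫ x in (0:ℝ)..1, (S.θx x t * S.flux x t
      + (S.θ x t - S.mean t) * (S.θt x t - S.stress x t * S.vx x t))
      = (S.θ 1 t - S.mean t) * S.flux 1 t - (S.θ 0 t - S.mean t) * S.flux 0 t :=
    integral_eq_sub_of_hasDerivWithinAt_Icc (f := fun x => (S.θ x t - S.mean t) * S.flux x t)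
      le_rfl zero_le_one le_rfl
      (fun x hx => ((S.hθx x hx t ht).sub_const _).fun_mul (S.hasDerivWithinAt_flux hx ht))
      (Continuous.intervalIntegrable (by fun_prop) _ _)
  rw [S.flux_zero ht, S.flux_one ht, mul_zero, mul_zero, sub_self] at h2
  have e : ∀ x, S.θx x t * S.flux x t
      + (S.θ x t - S.mean t) * (S.θt x t - S.stress x t * S.vx x t)
      = S.θx x t * S.flux x t + (S.θ x t * S.θt x t - S.mean t * S.θt x t
        - (S.θ x t - S.mean t) * (S.stress x t * S.vx x t)) := fun x => by ring
  simp only [e] at h2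
  rw [intervalIntegral.integral_add (Continuous.intervalIntegrable (by fun_prop) _ _)
      (Continuous.intervalIntegrable (by fun_prop) _ _),
    intervalIntegral.integral_sub (Continuous.intervalIntegrable (by fun_prop) _ _)
      (Continuous.intervalIntegrable (by fun_prop) _ _),
    intervalIntegral.integral_sub (Continuous.intervalIntegrable (by fun_prop) _ _)
      (Continuous.intervalIntegrable (by fun_prop) _ _),
    intervalIntegral.integral_const_mul] at h2
  refine ((h1.div_const 2).fun_sub
    (((h.hasDerivWithinAt_mean ht).fun_pow 2).div_const 2)).congr_deriv ?_
  rw [intervalIntegral.integral_const_mul]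
  norm_num
  linarith

/-- The variance production term is controlled by the dissipations when the temperature is
bounded above and below. -/
theorem integral_production_le_of_le_θ (h : S.IsGlobal) {t m k c ε : ℝ} (ht : 0 ≤ t) (hm : 0 < m)
    (hc : 0 < c) (hε : 0 < ε) (hmu : ∀ x ∈ Icc (0:ℝ) 1, m ≤ S.u x t)
    (hk : ∀ x ∈ Icc (0:ℝ) 1, S.θ x t ≤ k) (hcθ : ∀ x ∈ Icc (0:ℝ) 1, c ≤ S.θ x t) :
    ∫ x in (0:ℝ)..1, (S.θ x t - S.mean t) * (S.stress x t * S.vx x t)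
      ≤ 2 * ε * (c ^ (-S.β) * S.heat t) + k ^ 3 / (4 * ε * m) * S.V t
        + 1 / (4 * ε * m ^ 2) * S.defect t ^ 2 := by
  have hθ := h.θ; have hvx := h.vx; have hσ := h.continuous_stress
  have hdd := h.continuous_defectDensity.comp (Continuous.prodMk_left t)
  have hD := h.heat_nonneg t
  have hcβ : 0 ≤ c ^ (-S.β) := rpow_nonneg hc.le _
  set X := √(c ^ (-S.β) * S.heat t) with hX
  have hX0 : 0 ≤ X := Real.sqrt_nonneg _
  have hX2 : X ^ 2 = c ^ (-S.β) * S.heat t := Real.sq_sqrt (mul_nonneg hcβ hD)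
  have hosc : ∀ x ∈ Icc (0:ℝ) 1, ∀ y ∈ Icc (0:ℝ) 1, |S.θ x t - S.θ y t| ≤ X := by
    intro x hx y hy
    refine abs_le_of_sq_le_sq ?_ hX0
    have h1 := h.sq_rpow_sub_le_heat 1 hx hy ht
    rw [rpow_one, rpow_one] at h1
    rw [hX2, mul_comm]
    refine h1.trans (mul_le_mul_of_nonneg_left ?_ hD)
    refine (integral_unitInterval_mono (g := fun _ => c ^ (-S.β))
      (continuous_const.mul (h.continuous_rpow_slice _ t)) continuous_const fun z hz => ?_).trans
      (by simp)
    simp only [Pi.mul_apply]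
    rw [one_pow, one_mul, show 2 * 1 - 2 - S.β = -S.β by ring]
    exact rpow_le_rpow_of_nonpos hc (hcθ z hz) (neg_nonpos.2 S.hβ.le)
  have hd : ∀ x ∈ Icc (0:ℝ) 1, |S.θ x t - S.mean t| ≤ X := by
    intro x hx
    have h1 := integral_unitInterval_mono (f := fun y => S.θ y t) (g := fun _ => S.θ x t + X)
      (by fun_prop) (by fun_prop) fun y hy => by linarith [(abs_le.1 (hosc x hx y hy)).1]
    have h2 := integral_unitInterval_mono (f := fun _ => S.θ x t - X) (g := fun y => S.θ y t)
      (by fun_prop) (by fun_prop) fun y hy => by linarith [(abs_le.1 (hosc x hx y hy)).2]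
    rw [intervalIntegral.integral_const, sub_zero, one_smul] at h1 h2
    change S.mean t ≤ _ at h1
    change _ ≤ S.mean t at h2
    exact abs_le.2 ⟨by linarith, by linarith⟩
  have hpt : ∀ x ∈ Icc (0:ℝ) 1, (S.θ x t - S.mean t) * (S.stress x t * S.vx x t)
      ≤ X / m * (S.vx x t - S.θ x t) ^ 2 + (ε * X ^ 2 + k ^ 3 / (4 * ε * m)
        * ((S.vx x t - S.θ x t) ^ 2 / (S.u x t * S.θ x t))) := by
    intro x hx
    have hu := h.u_pos x t; have hθx := h.θ_pos x t
    have hdx := hd x hx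
    have hkx := pow_le_pow_left₀ hθx.le (hk x hx) 3
    have hmx := hmu x hx
    rw [stress]
    set d := S.θ x t - S.mean t
    set q := S.vx x t - S.θ x t with hq
    set r := S.u x t
    set y := S.θ x t
    have e : d * (q / r * S.vx x t) = d * (q ^ 2 / r) + d * (q * y / r) := by
      rw [hq]; field_simp; ring
    have b1 : d * (q ^ 2 / r) ≤ X / m * q ^ 2 := by
      calc d * (q ^ 2 / r) ≤ X * (q ^ 2 / m) := by
            refine mul_le_mul ((le_abs_self d).trans hdx) ?_ (by positivity) hX0
            gcongr
        _ = X / m * q ^ 2 := by ring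
    have b2 : d * (q * y / r) ≤ ε * d ^ 2 + (q * y / r) ^ 2 / (4 * ε) := by
      have := sq_nonneg (2 * ε * d - q * y / r)
      have e2 : ε * d ^ 2 + (q * y / r) ^ 2 / (4 * ε) - d * (q * y / r)
          = (2 * ε * d - q * y / r) ^ 2 / (4 * ε) := by field_simp; ring
      have : 0 ≤ (2 * ε * d - q * y / r) ^ 2 / (4 * ε) := by positivity
      linarith
    have b3 : d ^ 2 ≤ X ^ 2 := sq_le_sq' (abs_le.1 hdx).1 (abs_le.1 hdx).2
    have b4 : (q * y / r) ^ 2 / (4 * ε) ≤ k ^ 3 / (4 * ε * m) * (q ^ 2 / (r * y)) := by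
      calc (q * y / r) ^ 2 / (4 * ε) = y ^ 3 / (4 * ε * r) * (q ^ 2 / (r * y)) := by
            field_simp
        _ ≤ _ := by gcongr; exact (pow_pos hθx 3).le.trans hkx
    have b5 := mul_le_mul_of_nonneg_left b3 hε.le
    rw [e]
    linarith
  have hint := integral_unitInterval_mono (by fun_prop) (by fun_prop) hpt
  rw [intervalIntegral.integral_add (Continuous.intervalIntegrable (by fun_prop) _ _)
      (Continuous.intervalIntegrable (by fun_prop) _ _),
    intervalIntegral.integral_add (Continuous.intervalIntegrable (by fun_prop) _ _)
      (Continuous.intervalIntegrable (by fun_prop) _ _),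
    intervalIntegral.integral_const, sub_zero, one_smul, intervalIntegral.integral_const_mul,
    intervalIntegral.integral_const_mul] at hint
  change _ ≤ X / m * S.defect t + _ at hint
  have hk0 : 0 ≤ k := (h.θ_pos 0 t).le.trans (hk 0 ⟨le_rfl, zero_le_one⟩)
  have h3 := mul_le_mul_of_nonneg_left (h.integral_defectDensity_le_V t)
    (show 0 ≤ k ^ 3 / (4 * ε * m) by positivity)
  have h4 : X / m * S.defect t ≤ ε * X ^ 2 + 1 / (4 * ε * m ^ 2) * S.defect t ^ 2 := by
    have e2 : ε * X ^ 2 + 1 / (4 * ε * m ^ 2) * S.defect t ^ 2 - X / m * S.defect t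
        = (2 * ε * X - S.defect t / m) ^ 2 / (4 * ε) := by field_simp; ring
    have : 0 ≤ (2 * ε * X - S.defect t / m) ^ 2 / (4 * ε) := by positivity
    linarith
  rw [← hX2]
  linarith

/-- The variance production term is controlled by the defect and a pointwise bound of the
temperature. -/
theorem integral_production_le_of_θ_le (h : S.IsGlobal) {t m X s ε : ℝ} (ht : 0 ≤ t) (hm : 0 < m)
    (hs : 0 < s) (hε : 0 < ε) (hmu : ∀ x ∈ Icc (0:ℝ) 1, m ≤ S.u x t)
    (hX : ∀ x ∈ Icc (0:ℝ) 1, S.θ x t ≤ X) :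
    ∫ x in (0:ℝ)..1, (S.θ x t - S.mean t) * (S.stress x t * S.vx x t)
      ≤ (ε + S.E₀ / (2 * s * m)) * X ^ 2
        + (1 + s / 2) ^ 2 / (4 * ε * m ^ 2) * S.defect t ^ 2 := by
  have hθ := h.θ; have hvx := h.vx; have hσ := h.continuous_stress
  have hX0 : 0 ≤ X := (h.θ_pos 0 t).le.trans (hX 0 ⟨le_rfl, zero_le_one⟩)
  have hmX : S.mean t ≤ X := by
    have := integral_unitInterval_mono (f := fun y => S.θ y t) (g := fun _ => X)
      (by fun_prop) (by fun_prop) hX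
    rwa [intervalIntegral.integral_const, sub_zero, one_smul] at this
  have hpt : ∀ x ∈ Icc (0:ℝ) 1, (S.θ x t - S.mean t) * (S.stress x t * S.vx x t)
      ≤ X / m * (1 + s / 2) * (S.vx x t - S.θ x t) ^ 2 + X ^ 2 / (2 * s * m) * S.θ x t := by
    intro x hx
    have hu := h.u_pos x t; have hθx := h.θ_pos x t
    have hdx : |S.θ x t - S.mean t| ≤ X :=
      abs_le.2 ⟨by linarith, by linarith [hX x hx, h.mean_pos t]⟩
    have hXx := hX x hx
    have hmx := hmu x hx
    rw [stress]
    set d := S.θ x t - S.mean t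
    set q := S.vx x t - S.θ x t with hq
    set r := S.u x t
    set y := S.θ x t
    have b0 : |q * S.vx x t| ≤ (1 + s / 2) * q ^ 2 + X * y / (2 * s) := by
      have e1 : q * S.vx x t = q ^ 2 + q * y := by rw [hq]; ring
      have e2 : |q ^ 2 + q * y| ≤ q ^ 2 + |q| * y := by
        refine (abs_add_le _ _).trans (le_of_eq ?_)
        rw [abs_of_nonneg (sq_nonneg q), abs_mul, abs_of_pos hθx]
      have e3 : s / 2 * q ^ 2 + y ^ 2 / (2 * s) - |q| * y = (s * |q| - y) ^ 2 / (2 * s) := by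
        rw [← sq_abs q]; field_simp; ring
      have e4 : 0 ≤ (s * |q| - y) ^ 2 / (2 * s) := by positivity
      have e5 : y ^ 2 / (2 * s) ≤ X * y / (2 * s) := by
        rw [sq]
        gcongr
      rw [e1]
      linarith
    calc d * (q / r * S.vx x t) ≤ |d * (q / r * S.vx x t)| := le_abs_self _
      _ = |d| * (|q * S.vx x t| / r) := by
        rw [abs_mul, div_mul_eq_mul_div, abs_div, abs_of_pos hu]
      _ ≤ X * (((1 + s / 2) * q ^ 2 + X * y / (2 * s)) / m) := by gcongr
      _ = _ := by field_simp
  have hint := integral_unitInterval_mono (by fun_prop) (by fun_prop) hpt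
  rw [intervalIntegral.integral_add (Continuous.intervalIntegrable (by fun_prop) _ _)
      (Continuous.intervalIntegrable (by fun_prop) _ _),
    intervalIntegral.integral_const_mul, intervalIntegral.integral_const_mul] at hint
  change _ ≤ X / m * (1 + s / 2) * S.defect t + _ * S.mean t at hint
  have h3 := mul_le_mul_of_nonneg_left (h.mean_le ht)
    (show 0 ≤ X ^ 2 / (2 * s * m) by positivity)
  have e2 : ε * X ^ 2 + (1 + s / 2) ^ 2 / (4 * ε * m ^ 2) * S.defect t ^ 2
      - X / m * (1 + s / 2) * S.defect t
      = (2 * ε * X - (1 + s / 2) * S.defect t / m) ^ 2 / (4 * ε) := by field_simp; ring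
  have e3 : 0 ≤ (2 * ε * X - (1 + s / 2) * S.defect t / m) ^ 2 / (4 * ε) := by positivity
  have e4 : X ^ 2 / (2 * s * m) * S.E₀ = S.E₀ / (2 * s * m) * X ^ 2 := by ring
  linarith

/-- The variance production term is absorbed by the heat dissipation, up to the total
dissipation and the squared defect. -/
theorem exists_integral_production_le (h : S.IsGlobal) {η : ℝ} (hη : 0 < η) :
    ∃ C > 0, ∀ t, 0 ≤ t → ∫ x in (0:ℝ)..1, (S.θ x t - S.mean t) * (S.stress x t * S.vx x t)
      ≤ η * S.heat t + C * S.V t + C * S.defect t ^ 2 := by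
  obtain ⟨M, hM, huM⟩ := h.exists_u_le
  obtain ⟨m, hm, hmu⟩ := h.exists_le_u
  obtain ⟨δ, hδ, c, hc, hcθ⟩ := h.exists_le_θ_of_V_le hM
  obtain ⟨K₁, hK₁, hθ₁⟩ := h.exists_θ_le_V
  obtain ⟨K₂, hK₂, hθ₂⟩ := h.exists_sq_θ_le_heat
  have hE := h.E₀_pos
  set k := K₁ * (1 + δ * M) with hk
  have hk0 : 0 < k := by positivity
  set ε₁ := η / (2 * c ^ (-S.β)) with hε₁
  have hε₁0 : 0 < ε₁ := by positivity
  set ε₂ := η / (2 * K₂) with hε₂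
  have hε₂0 : 0 < ε₂ := by positivity
  set s := S.E₀ / (2 * m * ε₂) with hs
  have hs0 : 0 < s := by positivity
  set a₁ := k ^ 3 / (4 * ε₁ * m) with ha₁
  set a₂ := 1 / (4 * ε₁ * m ^ 2) with ha₂
  set a₃ := (1 + s / 2) ^ 2 / (4 * ε₂ * m ^ 2) with ha₃
  have h1 : 0 < a₁ := by positivity
  have h2 : 0 < a₂ := by positivity
  have h3 : 0 < a₃ := by positivity
  have h4 : 0 < η / δ := by positivity
  refine ⟨a₁ + a₂ + a₃ + η / δ, by positivity, fun t ht => ?_⟩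
  have hV := h.V_nonneg t
  have hF := sq_nonneg (S.defect t)
  have hD := h.heat_nonneg t
  rcases le_or_gt (S.V t) δ with hVδ | hVδ
  · have key := h.integral_production_le_of_le_θ ht hm hc hε₁0 (hmu t ht) (k := k)
      (fun x hx => (hθ₁ t ht M hM.le (huM t ht) x hx).trans (by rw [hk]; gcongr))
      (hcθ t ht (huM t ht) hVδ)
    have e : 2 * ε₁ * (c ^ (-S.β) * S.heat t) = η * S.heat t := by
      rw [hε₁]; field_simp
    rw [e] at key
    refine key.trans ?_
    gcongr <;> linarith
  · have hX2 : √(K₂ * (1 + S.heat t)) ^ 2 = K₂ * (1 + S.heat t) := Real.sq_sqrt (by positivity)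
    have key := h.integral_production_le_of_θ_le ht hm hs0 hε₂0 (hmu t ht)
      (fun x hx => Real.le_sqrt_of_sq_le (hθ₂ t ht x hx))
    have e : (ε₂ + S.E₀ / (2 * s * m)) * (K₂ * (1 + S.heat t)) = η * S.heat t + η := by
      rw [hs, hε₂]; field_simp; ring
    rw [hX2, e] at key
    have e2 : η ≤ η / δ * S.V t := by
      rw [div_mul_eq_mul_div, le_div_iff₀ hδ]
      gcongr
    have e3 : η / δ * S.V t ≤ (a₁ + a₂ + a₃ + η / δ) * S.V t := by
      gcongr
      linarith
    have e4 : a₃ * S.defect t ^ 2 ≤ (a₁ + a₂ + a₃ + η / δ) * S.defect t ^ 2 := by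
      gcongr
      linarith
    linarith

/-- The heat flux bound for globally extended solutions. -/
theorem exists_integral_heat_le (h : S.IsGlobal) : ∃ C > 0, ∀ T, 0 ≤ T →
    ∫ t in (0:ℝ)..T, S.heat t ≤ C + C * ∫ t in (0:ℝ)..T, S.defect t ^ 2 := by
  obtain ⟨M, hM, huM⟩ := h.exists_u_le
  obtain ⟨K, hK, L, hKL⟩ := h.exists_entropy_bounds
  obtain ⟨C, hC, hprod⟩ := h.exists_integral_production_le (η := 1 / (2 * M)) (by positivity)
  set N : ℝ → ℝ := fun t => (∫ x in (0:ℝ)..1, S.θ x t ^ 2) / 2 - S.mean t ^ 2 / 2 with hN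
  have hN0 : ∀ t, 0 ≤ N t := fun t => by
    have := h.sq_mean_le t
    simp only [hN]
    linarith
  have cD := h.continuous_heat; have cV := h.continuous_V; have cF := h.continuous_defect
  have hflux : ∀ t, 0 ≤ t →
      1 / M * S.heat t ≤ ∫ x in (0:ℝ)..1, S.θx x t * S.flux x t := by
    intro t ht
    have hθx := h.θx; have hF := h.continuous_flux
    have hp := h.continuous_rpow_slice S.β t
    rw [heat, ← intervalIntegral.integral_const_mul]
    refine integral_unitInterval_mono (by fun_prop) (by fun_prop) fun x hx => ?_
    have hu := h.u_pos x t; have hθ := h.θ_pos x t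
    calc 1 / M * (S.θ x t ^ S.β * S.θx x t ^ 2) ≤ 1 / S.u x t * (S.θ x t ^ S.β * S.θx x t ^ 2) := by
          gcongr
          exact huM t ht x hx
      _ = _ := by rw [flux]; ring
  have hint : ∀ {f : ℝ → ℝ}, Continuous f → ∀ t, HasDerivAt (fun s => ∫ r in (0:ℝ)..s, f r) (f t) t :=
    fun hf t => (hf.integral_hasStrictDerivAt 0 t).hasDerivAt
  have cF2 : Continuous fun t => S.defect t ^ 2 := by fun_prop
  refine ⟨2 * M * (N 0 + C * K + C), by have := hN0 0; positivity, fun T hT => ?_⟩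
  have hcomp := sub_le_sub_of_hasDerivWithinAt_le hT
    (fun t ht => h.hasDerivWithinAt_variance ht)
    (fun t _ => (((hint cV t).const_mul C).fun_add (((hint cF2 t).const_mul C).fun_sub
      ((hint cD t).const_mul (1 / (2 * M))))).hasDerivWithinAt)
    fun t ht _ => by
      have h1 := hprod t ht
      have h2 := hflux t ht
      have e : 1 / M * S.heat t = 1 / (2 * M) * S.heat t + 1 / (2 * M) * S.heat t := by
        field_simp; ring
      linarith
  simp only [intervalIntegral.integral_same, mul_zero, sub_zero, add_zero] at hcomp
  change N T - N 0 ≤ _ at hcomp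
  have hNT := hN0 T
  have hCK := mul_le_mul_of_nonneg_left (hKL T hT).1 hC.le
  have hI : 0 ≤ ∫ t in (0:ℝ)..T, S.defect t ^ 2 :=
    intervalIntegral.integral_nonneg hT fun t _ => sq_nonneg _
  have h1 : 1 / (2 * M) * ∫ t in (0:ℝ)..T, S.heat t
      ≤ (N 0 + C * K + C) + (N 0 + C * K + C) * ∫ t in (0:ℝ)..T, S.defect t ^ 2 := by
    have h2 : 0 ≤ (N 0 + C * K) * ∫ t in (0:ℝ)..T, S.defect t ^ 2 := by
      have := hN0 0; positivity
    linarith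
  have h3 := mul_le_mul_of_nonneg_left h1 (show 0 ≤ 2 * M by positivity)
  have e : 2 * M * (1 / (2 * M) * ∫ t in (0:ℝ)..T, S.heat t) = ∫ t in (0:ℝ)..T, S.heat t := by
    field_simp
  rw [e] at h3
  linarith

end IsGlobal

/-- Extension of a function on `[0,1] × [0,∞)` to the plane, constant along projections. -/
noncomputable def extend (f : ℝ → ℝ → ℝ) (x t : ℝ) : ℝ := f (max 0 (min x 1)) (max 0 t)

theorem extend_eq (f : ℝ → ℝ → ℝ) {x t : ℝ} (hx : x ∈ Icc (0:ℝ) 1) (ht : t ∈ Ici (0:ℝ)) :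
    extend f x t = f x t := by
  rw [extend, min_eq_left hx.2, max_eq_right hx.1, max_eq_right (mem_Ici.1 ht)]

theorem clamp_mem_Icc (x : ℝ) : max 0 (min x 1) ∈ Icc (0:ℝ) 1 :=
  ⟨le_max_left _ _, max_le zero_le_one (min_le_right _ _)⟩

theorem continuous_extend {f : ℝ → ℝ → ℝ}
    (hf : ContinuousOn (Function.uncurry f) (Icc 0 1 ×ˢ Ici 0)) :
    Continuous (Function.uncurry (extend f)) :=
  hf.comp_continuous (f := fun p : ℝ × ℝ => (max 0 (min p.1 1), max 0 p.2)) (by fun_prop)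
    fun p => ⟨clamp_mem_Icc p.1, le_max_left 0 p.2⟩

theorem hasDerivWithinAt_extend_left {f f' : ℝ → ℝ → ℝ} {x t : ℝ} (hx : x ∈ Icc (0:ℝ) 1)
    (ht : t ∈ Ici (0:ℝ)) (hf : HasDerivWithinAt (fun y => f y t) (f' x t) (Icc 0 1) x) :
    HasDerivWithinAt (fun y => extend f y t) (extend f' x t) (Icc 0 1) x := by
  rw [extend_eq f' hx ht]
  exact hf.congr_of_mem (fun y hy => extend_eq f hy ht) hx

theorem hasDerivWithinAt_extend_right {f f' : ℝ → ℝ → ℝ} {x t : ℝ} (hx : x ∈ Icc (0:ℝ) 1)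
    (ht : t ∈ Ici (0:ℝ)) (hf : HasDerivWithinAt (fun s => f x s) (f' x t) (Ici 0) t) :
    HasDerivWithinAt (fun s => extend f x s) (extend f' x t) (Ici 0) t := by
  rw [extend_eq f' hx ht]
  exact hf.congr_of_mem (fun s hs => extend_eq f hx hs) ht

/-- The solution with all its fields extended to the plane. -/
noncomputable def globalize (S : NSSol) : NSSol where
  β := S.β
  hβ := S.hβ
  u := extend S.u
  v := extend S.v
  θ := extend S.θ
  ux := extend S.ux
  ut := extend S.ut
  vx := extend S.vx
  vt := extend S.vt
  vxx := extend S.vxx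
  θx := extend S.θx
  θt := extend S.θt
  θxx := extend S.θxx
  hu_pos x _ t _ := S.hu_pos _ (clamp_mem_Icc x) _ (le_max_left 0 t)
  hθ_pos x _ t _ := S.hθ_pos _ (clamp_mem_Icc x) _ (le_max_left 0 t)
  hux x hx t ht := hasDerivWithinAt_extend_left hx ht (S.hux x hx t ht)
  hut x hx t ht := hasDerivWithinAt_extend_right hx ht (S.hut x hx t ht)
  hvx x hx t ht := hasDerivWithinAt_extend_left hx ht (S.hvx x hx t ht)
  hvt x hx t ht := hasDerivWithinAt_extend_right hx ht (S.hvt x hx t ht)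
  hvxx x hx t ht := hasDerivWithinAt_extend_left hx ht (S.hvxx x hx t ht)
  hθx x hx t ht := hasDerivWithinAt_extend_left hx ht (S.hθx x hx t ht)
  hθt x hx t ht := hasDerivWithinAt_extend_right hx ht (S.hθt x hx t ht)
  hθxx x hx t ht := hasDerivWithinAt_extend_left hx ht (S.hθxx x hx t ht)
  hu_cont := (continuous_extend S.hu_cont).continuousOn
  hv_cont := (continuous_extend S.hv_cont).continuousOn
  hθ_cont := (continuous_extend S.hθ_cont).continuousOn
  hux_cont := (continuous_extend S.hux_cont).continuousOn
  hut_cont := (continuous_extend S.hut_cont).continuousOn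
  hvx_cont := (continuous_extend S.hvx_cont).continuousOn
  hvt_cont := (continuous_extend S.hvt_cont).continuousOn
  hvxx_cont := (continuous_extend S.hvxx_cont).continuousOn
  hθx_cont := (continuous_extend S.hθx_cont).continuousOn
  hθt_cont := (continuous_extend S.hθt_cont).continuousOn
  hθxx_cont := (continuous_extend S.hθxx_cont).continuousOn
  mass x _ t _ := S.mass _ (clamp_mem_Icc x) _ (le_max_left 0 t)
  momentum x hx t ht := hasDerivWithinAt_extend_left
    (f := fun y t => (S.vx y t - S.θ y t) / S.u y t) hx ht (S.momentum x hx t ht)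
  energyEq x hx t ht := hasDerivWithinAt_extend_left
    (f := fun y t => S.θ y t ^ S.β * S.θx y t / S.u y t)
    (f' := fun x t => S.θt x t + S.θ x t * S.vx x t / S.u x t - (S.vx x t) ^ 2 / S.u x t)
    hx ht (S.energyEq x hx t ht)
  bc0 t ht := by
    simpa only [extend_eq _ (left_mem_Icc.2 (zero_le_one' ℝ)) ht] using S.bc0 t ht
  bc1 t ht := by
    simpa only [extend_eq _ (right_mem_Icc.2 (zero_le_one' ℝ)) ht] using S.bc1 t ht
  bcθ0 t ht := by
    simpa only [extend_eq _ (left_mem_Icc.2 (zero_le_one' ℝ)) ht] using S.bcθ0 t ht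
  bcθ1 t ht := by
    simpa only [extend_eq _ (right_mem_Icc.2 (zero_le_one' ℝ)) ht] using S.bcθ1 t ht

theorem isGlobal_globalize (S : NSSol) : S.globalize.IsGlobal where
  u := continuous_extend S.hu_cont
  v := continuous_extend S.hv_cont
  θ := continuous_extend S.hθ_cont
  vx := continuous_extend S.hvx_cont
  vt := continuous_extend S.hvt_cont
  θx := continuous_extend S.hθx_cont
  θt := continuous_extend S.hθt_cont
  u_pos x t := S.hu_pos _ (clamp_mem_Icc x) _ (le_max_left 0 t)
  θ_pos x t := S.hθ_pos _ (clamp_mem_Icc x) _ (le_max_left 0 t)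

theorem heat_globalize (S : NSSol) {t : ℝ} (ht : 0 ≤ t) : S.globalize.heat t = S.heat t := by
  refine intervalIntegral.integral_congr fun x hx => ?_
  rw [uIcc_of_le zero_le_one] at hx
  simp only [globalize, extend_eq _ hx (mem_Ici.2 ht)]

theorem defect_globalize (S : NSSol) {t : ℝ} (ht : 0 ≤ t) : S.globalize.defect t = S.defect t := by
  refine intervalIntegral.integral_congr fun x hx => ?_
  rw [uIcc_of_le zero_le_one] at hx
  simp only [globalize, extend_eq _ hx (mem_Ici.2 ht)]

end NSSol


/-- Conditional bound on the weighted heat flux: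
`∫₀ᵀ∫₀¹ θ^β θ_x² ≤ C + C ∫₀ᵀ (∫₀¹ (w_x + u − θ)²)² dt`, where `w_x + u − θ = v_x − θ`. -/
theorem weighted_heat_flux_bound (S : NSSol) :
    ∃ C > (0:ℝ), ∀ T > (0:ℝ),
      (∫ t in (0:ℝ)..T, ∫ x in (0:ℝ)..1, S.θ x t ^ S.β * (S.θx x t) ^ 2)
        ≤ C + C * ∫ t in (0:ℝ)..T,
            (∫ x in (0:ℝ)..1, (S.vx x t - S.θ x t) ^ 2) ^ 2 := by
  obtain ⟨C, hC, hle⟩ := S.isGlobal_globalize.exists_integral_heat_le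
  refine ⟨C, hC, fun T hT => ?_⟩
  have h1 : ∫ t in (0:ℝ)..T, S.globalize.heat t = ∫ t in (0:ℝ)..T, S.heat t := by
    refine intervalIntegral.integral_congr fun t ht => ?_
    rw [uIcc_of_le hT.le] at ht
    exact S.heat_globalize ht.1
  have h2 : ∫ t in (0:ℝ)..T, S.globalize.defect t ^ 2 = ∫ t in (0:ℝ)..T, S.defect t ^ 2 := by
    refine intervalIntegral.integral_congr fun t ht => ?_
    rw [uIcc_of_le hT.le] at ht
    simp only [S.defect_globalize ht.1]
  have := hle T hT.le
  rw [h1, h2] at this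
  exact this
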